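/- Let G and H be finitely generated groups and suppose G simulates H through an epimorphism ρ : G → H, meaning the pullback ρ*(X) of every effective H-subshift X is a sofic G-subshift. Then: (1) M_eff(H) ⊆ M_sof(G); (2) if H is infinite and recursively presented, then M_SFT(G) contains a Medvedev degree bounded below by the maximal Π⁰₁ Medvedev degree; (3) if H is infinite with decidable word problem, then M_sof(G) contains all Π⁰₁ Medvedev degrees. -/

import Mathlib

namespace MedvedevFormal

/-! ### Medvedev reducibility on Baire space -/

/-- The finite prefix of length `k` of a point of Baire space, as a list. -/
def pref (x : ℕ → ℕ) (k : ℕ) : List ℕ := (List.range k).map x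

/-- Medvedev reducibility `m(P) ≤ m(Q)` between subsets of Baire space: some computable
monotone prefix-functional (i.e. a partial computable type-two functional), defined on all
of `Q`, maps every element of `Q` to an element of `P`. -/
def BaireLE (P Q : Set (ℕ → ℕ)) : Prop :=
  ∃ φ : List ℕ → List ℕ, Computable φ ∧
    (∀ l₁ l₂ : List ℕ, l₁ <+: l₂ → φ l₁ <+: φ l₂) ∧
    ∀ x ∈ Q, ∃ y ∈ P, ∀ n : ℕ, ∃ k : ℕ, (φ (pref x k))[n]? = some (y n)

/-- Medvedev equivalence: `m(P) = m(Q)`. -/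
def BaireEquiv (P Q : Set (ℕ → ℕ)) : Prop := BaireLE P Q ∧ BaireLE Q P

/-- A canonical representative of the join `m(P) ∨ m(Q)`. -/
def joinSet (P Q : Set (ℕ → ℕ)) : Set (ℕ → ℕ) :=
  {x | (fun n => x (2 * n)) ∈ P ∧ (fun n => x (2 * n + 1)) ∈ Q}

/-- A canonical representative of the meet `m(P) ∧ m(Q)`. -/
def meetSet (P Q : Set (ℕ → ℕ)) : Set (ℕ → ℕ) :=
  {x | (x 0 = 0 ∧ (fun n => x (n + 1)) ∈ P) ∨ (x 0 = 1 ∧ (fun n => x (n + 1)) ∈ Q)}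

/-- `P` has the zero Medvedev degree `0_M`: it contains a computable point. -/
def IsZeroDeg (P : Set (ℕ → ℕ)) : Prop := ∃ y ∈ P, Computable y

/-- The cylinder of a finite word in Baire space. -/
def cylinder (l : List ℕ) : Set (ℕ → ℕ) :=
  {x | ∀ (i : ℕ) (h : i < l.length), x i = l[i]}

/-- Cantor space `{0,1}^ℕ` inside Baire space. -/
def cantorSpace : Set (ℕ → ℕ) := {x | ∀ n, x n ≤ 1}

/-- `P` is an effectively closed (`Π⁰₁`) subset of Cantor space: its complement within
Cantor space is the union of the cylinders of a computably enumerable sequence of words. -/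
def IsPi01Cantor (P : Set (ℕ → ℕ)) : Prop :=
  ∃ f : ℕ → List ℕ, Computable f ∧ P = cantorSpace \ ⋃ n, cylinder (f n)

/-- The Medvedev degree of `P` is a `Π⁰₁` Medvedev degree. -/
def IsPi01Deg (P : Set (ℕ → ℕ)) : Prop :=
  ∃ Q, IsPi01Cantor Q ∧ Q.Nonempty ∧ BaireEquiv P Q

/-- `P` realizes the maximal `Π⁰₁` Medvedev degree (the degree of the class of complete
consistent extensions of Peano arithmetic): it is a nonempty `Π⁰₁` subset of Cantor space
to which every nonempty `Π⁰₁` subset of Cantor space is Medvedev reducible. -/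
def IsMaxPi01 (P : Set (ℕ → ℕ)) : Prop :=
  IsPi01Cantor P ∧ P.Nonempty ∧ ∀ Q, IsPi01Cantor Q → Q.Nonempty → BaireLE Q P

/-! ### Encoding of configuration spaces -/

/-- The canonical encoding of a configuration `x : α → A` as a point of Baire space. -/
def confFun {α A : Type*} [Encodable α] [Encodable A] (x : α → A) : ℕ → ℕ :=
  fun n => Encodable.encode ((Encodable.decode (α := α) n).map x)

/-- The image of a set of configurations in Baire space, used to measure its
Medvedev degree. -/
def mSet {α A : Type*} [Encodable α] [Encodable A] (X : Set (α → A)) : Set (ℕ → ℕ) :=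
  confFun '' X

/-- A configuration is computable if its Baire-space encoding is computable. -/
def ComputablePoint {α A : Type*} [Encodable α] [Encodable A] (x : α → A) : Prop :=
  Computable (confFun x)

/-- `m(X) ≤ m(Y)` for sets of configurations. -/
def MedLE {α A β B : Type*} [Encodable α] [Encodable A] [Encodable β] [Encodable B]
    (X : Set (α → A)) (Y : Set (β → B)) : Prop :=
  BaireLE (mSet X) (mSet Y)

/-- `m(X) = m(Y)` for sets of configurations. -/
def MedEquiv {α A β B : Type*} [Encodable α] [Encodable A] [Encodable β] [Encodable B]
    (X : Set (α → A)) (Y : Set (β → B)) : Prop :=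
  MedLE X Y ∧ MedLE Y X

/-! ### Subshifts -/

/-- The left shift action: `(g • x) h = x (g⁻¹ h)`. -/
def shift {G A : Type*} [Group G] (g : G) (x : G → A) : G → A := fun h => x (g⁻¹ * h)

/-- The prodiscrete topology on `A^G`. -/
def prodiscrete (G A : Type*) : TopologicalSpace (G → A) :=
  @Pi.topologicalSpace G (fun _ => A) fun _ => ⊥

/-- A subshift: a shift-invariant subset of `A^G`, closed in the prodiscrete topology. -/
def IsSubshift {G A : Type*} [Group G] (X : Set (G → A)) : Prop :=
  (∀ x ∈ X, ∀ g : G, shift g x ∈ X) ∧ @IsClosed (G → A) (prodiscrete G A) X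

/-- A pattern: a map `p : D → A` with `D ⊆ G` finite. -/
structure Pattern (G A : Type*) where
  dom : Finset G
  val : {g // g ∈ dom} → A

/-- The translate `g • x` agrees with the pattern `p` on its domain. -/
def MatchesAt {G A : Type*} [Group G] (p : Pattern G A) (g : G) (x : G → A) : Prop :=
  ∀ h : {g' // g' ∈ p.dom}, shift g x h = p.val h

/-- A subshift of finite type: defined by a finite list of forbidden patterns. -/
def IsSFT {G A : Type*} [Group G] (X : Set (G → A)) : Prop :=
  ∃ F : List (Pattern G A), X = {x | ∀ p ∈ F, ∀ g : G, ¬MatchesAt p g x}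

/-- A morphism between subshifts: a continuous shift-equivariant map from `X` to `Y`. -/
def IsMorphism {G A B : Type*} [Group G] (X : Set (G → A)) (Y : Set (G → B))
    (φ : (G → A) → (G → B)) : Prop :=
  Set.MapsTo φ X Y ∧
    @ContinuousOn (G → A) (G → B) (prodiscrete G A) (prodiscrete G B) φ X ∧
    ∀ x ∈ X, ∀ g : G, φ (shift g x) = shift g (φ x)

/-- A sofic subshift: the image of an SFT (on some finite alphabet) under a topological
factor map. -/
def IsSofic {G A : Type*} [Group G] (X : Set (G → A)) : Prop :=
  ∃ (B : Type) (_ : Finite B) (Y : Set (G → B)) (φ : (G → B) → (G → A)),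
    IsSFT Y ∧ IsMorphism Y X φ ∧ φ '' Y = X

/-! ### Finitely generated groups, covers and pullbacks -/

/-- `σ` enumerates a finite symmetric generating set of `G`. -/
def IsSymmGen {G : Type*} [Group G] {k : ℕ} (σ : Fin k → G) : Prop :=
  Subgroup.closure (Set.range σ) = ⊤ ∧ ∀ i, (σ i)⁻¹ ∈ Set.range σ

/-- The canonical encoding of a free group via reduced words. -/
instance freeGroupEncodable {α : Type*} [DecidableEq α] [Encodable α] :
    Encodable (FreeGroup α) :=
  Encodable.ofLeftInjection FreeGroup.toWord (fun l => some (FreeGroup.mk l))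
    fun _ => congrArg some FreeGroup.mk_toWord

/-- The canonical homomorphism from the free group determined by `σ`. -/
def cover {G : Type*} [Group G] {k : ℕ} (σ : Fin k → G) : FreeGroup (Fin k) →* G :=
  FreeGroup.lift σ

/-- The pullback of a subshift along a group homomorphism. -/
def pullback {K G A : Type*} [Group K] [Group G] (ρ : K →* G) (X : Set (G → A)) :
    Set (K → A) :=
  (fun x => x ∘ ρ) '' X

/-- The group element represented by a word over the generators. -/
def wordVal {G : Type*} [Group G] {k : ℕ} (σ : Fin k → G) (w : List (Fin k × Bool)) : G :=
  cover σ (FreeGroup.mk w)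

/-- `G` is recursively presented w.r.t. `σ`: its word problem is recursively enumerable. -/
def RecursivelyPresented {G : Type*} [Group G] {k : ℕ} (σ : Fin k → G) : Prop :=
  ∃ f : ℕ → Option (List (Fin k × Bool)), Computable f ∧
    ∀ w : List (Fin k × Bool), (wordVal σ w = 1 ↔ ∃ n, f n = some w)

/-- The membership problem of the subgroup `H` in `G` is decidable w.r.t. `σ`. -/
def DecidableMembership {G : Type*} [Group G] {k : ℕ} (σ : Fin k → G)
    (H : Subgroup G) : Prop :=
  ∃ φ : List (Fin k × Bool) → Bool, Computable φ ∧
    ∀ w : List (Fin k × Bool), (φ w = true ↔ wordVal σ w ∈ H)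

/-- `G` has decidable word problem w.r.t. `σ`. -/
def DecidableWordProblem {G : Type*} [Group G] {k : ℕ} (σ : Fin k → G) : Prop :=
  ∃ φ : List (Fin k × Bool) → Bool, Computable φ ∧
    ∀ w : List (Fin k × Bool), (φ w = true ↔ wordVal σ w = 1)

/-- The set of configurations on the free group matching a coded pattern: a pattern is
coded as a list of pairs (code of a group element, code of a letter). -/
def codedCylinder {k : ℕ} {A : Type*} [Encodable A] (p : List (ℕ × ℕ)) :
    Set (FreeGroup (Fin k) → A) :=
  {x | ∀ q ∈ p, ∀ g : FreeGroup (Fin k),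
    Encodable.encode g = q.1 → Encodable.encode (x g) = q.2}

/-- `X` is an effective subshift: the complement of its pullback to the free group is the
union of the cylinders of a computably enumerable sequence of finitely supported patterns. -/
def IsEffective {G : Type*} [Group G] {k : ℕ} (σ : Fin k → G) {A : Type*} [Encodable A]
    (X : Set (G → A)) : Prop :=
  ∃ f : ℕ → List (ℕ × ℕ), Computable f ∧
    (pullback (cover σ) X)ᶜ = ⋃ n, codedCylinder (f n)

/-! ### Degree spectra -/

/-- The Medvedev degree of `P` belongs to `M_SFT(G)`: some nonempty `G`-SFT has the
Medvedev degree of `P`. -/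
def IsSFTDeg {G : Type*} [Group G] {k : ℕ} (σ : Fin k → G) (P : Set (ℕ → ℕ)) : Prop :=
  ∃ (n : ℕ) (X : Set (G → Fin n)), IsSFT X ∧ X.Nonempty ∧
    BaireEquiv (mSet (pullback (cover σ) X)) P

/-- The Medvedev degree of `P` belongs to `M_sof(G)`. -/
def IsSoficDeg {G : Type*} [Group G] {k : ℕ} (σ : Fin k → G) (P : Set (ℕ → ℕ)) : Prop :=
  ∃ (n : ℕ) (X : Set (G → Fin n)), IsSofic X ∧ X.Nonempty ∧
    BaireEquiv (mSet (pullback (cover σ) X)) P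

/-- The Medvedev degree of `P` belongs to `M_eff(G)`. -/
def IsEffDeg {G : Type*} [Group G] {k : ℕ} (σ : Fin k → G) (P : Set (ℕ → ℕ)) : Prop :=
  ∃ (n : ℕ) (X : Set (G → Fin n)), IsSubshift X ∧ IsEffective σ X ∧ X.Nonempty ∧
    BaireEquiv (mSet (pullback (cover σ) X)) P

/-! ### Word metrics and quasi-isometries -/

/-- The word length of `g` w.r.t. the (symmetric) generating map `σ`. -/
noncomputable def wordNorm {G : Type*} [Group G] {k : ℕ} (σ : Fin k → G) (g : G) : ℕ :=
  sInf {n | ∃ w : List (Fin k), w.length = n ∧ (w.map σ).prod = g}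

/-- The word metric on `G` w.r.t. `σ`, as a real number. -/
noncomputable def wordDist {G : Type*} [Group G] {k : ℕ} (σ : Fin k → G) (g g' : G) : ℝ :=
  (wordNorm σ (g⁻¹ * g') : ℝ)

/-- `f : G → H` is a quasi-isometry w.r.t. the word metrics given by `σ` and `τ`. -/
def IsQIGroups {G H : Type*} [Group G] [Group H] {k r : ℕ} (σ : Fin k → G)
    (τ : Fin r → H) (f : G → H) : Prop :=
  ∃ C : ℝ, 1 ≤ C ∧
    (∀ g g' : G, (1 / C) * wordDist σ g g' - C ≤ wordDist τ (f g) (f g') ∧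
      wordDist τ (f g) (f g') ≤ C * wordDist σ g g' + C) ∧
    ∀ h : H, ∃ g : G, wordDist τ h (f g) ≤ C

/-- `f : G → Y` is a quasi-isometry from the group `G` (with word metric from `σ`) to the
metric space `Y`. -/
def IsQIToSpace {G : Type*} [Group G] {k : ℕ} (σ : Fin k → G) {Y : Type*}
    [MetricSpace Y] (f : G → Y) : Prop :=
  ∃ C : ℝ, 1 ≤ C ∧
    (∀ g g' : G, (1 / C) * wordDist σ g g' - C ≤ dist (f g) (f g') ∧
      dist (f g) (f g') ≤ C * wordDist σ g g' + C) ∧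
    ∀ y : Y, ∃ g : G, dist y (f g) ≤ C

/-- `f : G → H` is computable w.r.t. the generating maps `σ` and `τ`: some computable map
on words sends each word representing `g` to a word representing `f g`. -/
def ComputableMap {G H : Type*} [Group G] [Group H] {k r : ℕ} (σ : Fin k → G)
    (τ : Fin r → H) (f : G → H) : Prop :=
  ∃ φ : List (Fin k × Bool) → List (Fin r × Bool), Computable φ ∧
    ∀ w : List (Fin k × Bool), wordVal τ (φ w) = f (wordVal σ w)

/-! ### Computability of list operations -/

theorem computable_list_map {α β γ : Type*} [Primcodable α] [Primcodable β] [Primcodable γ]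
    {f : α → List β} {g : α → β → γ} (hf : Computable f) (hg : Computable₂ g) :
    Computable fun a => (f a).map (g a) := by
  have key : Computable fun a => (Nat.rec (motive := fun _ => List γ) []
      (fun i acc => acc ++ (((f a)[i]?).map (g a)).toList) (f a).length : List γ) := by
    have hopt : Computable fun a : α × ℕ × List γ => ((f a.1)[a.2.1]?).map (g a.1) :=
      Computable.option_map (Computable.list_getElem?.comp (hf.comp Computable.fst)
        (Computable.fst.comp Computable.snd))
        (hg.comp (Computable.fst.comp Computable.fst) Computable.snd).to₂
    have hstep : Computable fun a : α × ℕ × List γ =>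
        a.2.2 ++ (((f a.1)[a.2.1]?).map (g a.1)).toList :=
      Computable.list_append.comp (Computable.snd.comp Computable.snd)
        ((Primrec.optionToList (α := γ)).to_comp.comp hopt)
    exact Computable.nat_rec (h := fun a q => q.2 ++ (((f a)[q.1]?).map (g a)).toList)
      (Computable.list_length.comp hf) (Computable.const []) hstep.to₂
  refine key.of_eq fun a => ?_
  have : ∀ n ≤ (f a).length, (Nat.rec (motive := fun _ => List γ) []
      (fun i acc => acc ++ (((f a)[i]?).map (g a)).toList) n : List γ)
        = ((f a).take n).map (g a) := by
    intro n
    induction n with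
    | zero => simp
    | succ n ih =>
      intro hn
      have h1 : n < (f a).length := hn
      simp only [ih h1.le]
      rw [List.take_add_one, List.map_append, List.getElem?_eq_getElem h1]
      rfl
  rw [this _ le_rfl]
  simp

theorem computable_list_any {α β : Type*} [Primcodable α] [Primcodable β]
    {f : α → List β} {p : α → β → Bool} (hf : Computable f) (hp : Computable₂ p) :
    Computable fun a => (f a).any (p a) := by
  have h1 : Primrec fun l : List Bool => decide (∃ b ∈ l, b = true) :=
    (PrimrecPred.exists_mem_list (p := fun b : Bool => b = true)
      (Primrec.eq.comp Primrec.id (Primrec.const _))).decide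
  refine (h1.to_comp.comp (computable_list_map hf hp)).of_eq fun a => ?_
  rw [Bool.eq_iff_iff]
  simp

/-! ### Prefixes of points of Baire space -/

theorem pref_length (x : ℕ → ℕ) (k : ℕ) : (pref x k).length = k := by simp [pref]

theorem pref_getElem? (x : ℕ → ℕ) {k i : ℕ} (h : i < k) : (pref x k)[i]? = some (x i) := by
  simp [pref, h]

theorem pref_getD (x : ℕ → ℕ) {k i : ℕ} (h : i < k) : (pref x k).getD i 0 = x i := by
  simp [List.getD, pref_getElem? x h]

theorem pref_take (x : ℕ → ℕ) {j k : ℕ} (h : j ≤ k) : (pref x k).take j = pref x j := by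
  simp [pref, ← List.map_take, List.take_range, h]

theorem pref_prefix (x : ℕ → ℕ) {j k : ℕ} (h : j ≤ k) : pref x j <+: pref x k := by
  rw [← pref_take x h]; exact List.take_prefix _ _

theorem pref_succ (x : ℕ → ℕ) (k : ℕ) : pref x (k + 1) = pref x k ++ [x k] := by
  simp [pref, List.range_succ]

theorem pref_prefix_iff (x : ℕ → ℕ) (l : List ℕ) :
    l <+: pref x l.length ↔ x ∈ cylinder l := by
  constructor
  · intro h i hi
    have := h.getElem hi
    simp [pref] at this
    exact this.symm
  · intro h
    have : l = pref x l.length := by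
      apply List.ext_getElem
      · simp [pref]
      · intro i h1 h2
        simp [pref, h i h1]
    rw [← this]

theorem getElem?_eq_some_of_prefix {α : Type*} {l₁ l₂ : List α} (h : l₁ <+: l₂) {n : ℕ} {a : α}
    (ha : l₁[n]? = some a) : l₂[n]? = some a := by
  obtain ⟨t, rfl⟩ := h
  obtain ⟨hn, rfl⟩ := List.getElem?_eq_some_iff.1 ha
  rw [List.getElem?_append_left hn, ha]

/-! ### Medvedev reductions -/

theorem BaireLE.trans {P Q R : Set (ℕ → ℕ)} (h₁ : BaireLE P Q) (h₂ : BaireLE Q R) :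
    BaireLE P R := by
  obtain ⟨φ, hφ, mφ, rφ⟩ := h₁
  obtain ⟨ψ, hψ, mψ, rψ⟩ := h₂
  refine ⟨fun l => φ (ψ l), hφ.comp hψ, fun l₁ l₂ h => mφ _ _ (mψ _ _ h), fun x hx => ?_⟩
  obtain ⟨y, hy, hxy⟩ := rψ x hx
  obtain ⟨z, hz, hyz⟩ := rφ y hy
  have hpre : ∀ k, ∃ m, pref y k <+: ψ (pref x m) := by
    intro k
    choose m hm using hxy
    refine ⟨((List.range k).map m).sum, ?_⟩
    rw [List.prefix_iff_getElem?]
    intro i hi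
    rw [pref_length] at hi
    have hle : m i ≤ ((List.range k).map m).sum :=
      List.le_sum_of_mem (List.mem_map.2 ⟨i, by simpa using hi, rfl⟩)
    have h1 := mψ _ _ (pref_prefix x hle)
    have h2 : (ψ (pref x (((List.range k).map m).sum)))[i]? = some (y i) :=
      getElem?_eq_some_of_prefix h1 (hm i)
    rw [h2]
    simp [pref]
  refine ⟨z, hz, fun n => ?_⟩
  obtain ⟨k, hk⟩ := hyz n
  obtain ⟨m, hm⟩ := hpre k
  exact ⟨m, getElem?_eq_some_of_prefix (mφ _ _ hm) hk⟩

/-- The output of a truth-table functional with use `c` and evaluation `Ψ`, restricted to the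
first `n` values. -/
def ttOut (c : ℕ → ℕ) (Ψ : ℕ → List ℕ → ℕ) (l : List ℕ) (n : ℕ) : List ℕ :=
  Nat.rec [] (fun i acc =>
    if acc.length = i ∧ c i ≤ l.length then acc ++ [Ψ i (l.take (c i))] else acc) n

theorem ttOut_succ (c : ℕ → ℕ) (Ψ : ℕ → List ℕ → ℕ) (l : List ℕ) (n : ℕ) :
    ttOut c Ψ l (n + 1) = if (ttOut c Ψ l n).length = n ∧ c n ≤ l.length then
      ttOut c Ψ l n ++ [Ψ n (l.take (c n))] else ttOut c Ψ l n := rfl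

theorem ttOut_length_le (c : ℕ → ℕ) (Ψ : ℕ → List ℕ → ℕ) (l : List ℕ) (n : ℕ) :
    (ttOut c Ψ l n).length ≤ n := by
  induction n with
  | zero => simp [ttOut]
  | succ n ih =>
    rw [ttOut_succ]
    split_ifs
    · simpa using ih
    · omega

theorem ttOut_mono (c : ℕ → ℕ) (Ψ : ℕ → List ℕ → ℕ) (l : List ℕ) {m n : ℕ} (h : m ≤ n) :
    ttOut c Ψ l m <+: ttOut c Ψ l n := by
  induction n, h using Nat.le_induction with
  | base => exact List.prefix_rfl
  | succ n _ ih =>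
    rw [ttOut_succ]
    split_ifs
    · exact ih.trans (List.prefix_append _ _)
    · exact ih

theorem ttOut_prefix (c : ℕ → ℕ) (Ψ : ℕ → List ℕ → ℕ) {l l' : List ℕ} (h : l <+: l') (n : ℕ) :
    ttOut c Ψ l n <+: ttOut c Ψ l' n := by
  induction n with
  | zero => simp [ttOut]
  | succ n ih =>
    by_cases hc : (ttOut c Ψ l n).length = n ∧ c n ≤ l.length
    · have heq : ttOut c Ψ l n = ttOut c Ψ l' n := by
        apply ih.eq_of_length_le
        have := ttOut_length_le c Ψ l' n
        omega
      have hl := h.length_le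
      rw [ttOut_succ, ttOut_succ, if_pos hc, if_pos ⟨heq ▸ hc.1, by omega⟩, heq]
      rw [(h.take (c n)).eq_of_length_le (by simp; omega)]
    · rw [ttOut_succ, if_neg hc]
      exact ih.trans (ttOut_mono c Ψ l' (Nat.le_succ n))

theorem ttOut_pref (c : ℕ → ℕ) (Ψ : ℕ → List ℕ → ℕ) (x : ℕ → ℕ) {k : ℕ} (n : ℕ)
    (h : ∀ i < n, c i ≤ k) :
    ttOut c Ψ (pref x k) n = pref (fun i => Ψ i (pref x (c i))) n := by
  induction n with
  | zero => simp [ttOut, pref]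
  | succ n ih =>
    have ih' := ih fun i hi => h i (by omega)
    have hn : c n ≤ (pref x k).length := by
      rw [pref_length]
      exact h n (by omega)
    rw [ttOut_succ, ih', pref_succ, if_pos ⟨pref_length _ _, hn⟩, pref_take _ (h n (by omega))]

/-- A computable truth-table functional yields a Medvedev reduction. -/
theorem BaireLE.of_tt {P Q : Set (ℕ → ℕ)} (c : ℕ → ℕ) (Ψ : ℕ → List ℕ → ℕ)
    (hc : Computable c) (hΨ : Computable₂ Ψ)
    (h : ∀ x ∈ Q, (fun n => Ψ n (pref x (c n))) ∈ P) : BaireLE P Q := by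
  refine ⟨fun l => ttOut c Ψ l l.length, ?_, ?_, ?_⟩
  · have hcond : Primrec fun q : List ℕ × ℕ × ℕ × ℕ =>
        decide (q.1.length = q.2.1 ∧ q.2.2.1 ≤ q.2.2.2) := by
      refine PrimrecPred.decide (PrimrecPred.and ?_ ?_)
      · exact Primrec.eq.comp (Primrec.list_length.comp Primrec.fst)
          (Primrec.fst.comp Primrec.snd)
      · exact Primrec.nat_le.comp (Primrec.fst.comp (Primrec.snd.comp Primrec.snd))
          (Primrec.snd.comp (Primrec.snd.comp Primrec.snd))
    have hi : Computable fun a : List ℕ × ℕ × List ℕ => a.2.1 :=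
      Computable.fst.comp Computable.snd
    have hacc : Computable fun a : List ℕ × ℕ × List ℕ => a.2.2 :=
      Computable.snd.comp Computable.snd
    have hl : Computable fun a : List ℕ × ℕ × List ℕ => a.1 := Computable.fst
    refine (Computable.nat_rec (h := fun (l : List ℕ) (a : ℕ × List ℕ) =>
      bif decide (a.2.length = a.1 ∧ c a.1 ≤ l.length) then
        a.2 ++ [Ψ a.1 (l.take (c a.1))] else a.2)
      Computable.list_length (Computable.const []) ?_).of_eq ?_
    · have hif : Computable fun a : List ℕ × ℕ × List ℕ =>
          decide (a.2.2.length = a.2.1 ∧ c a.2.1 ≤ a.1.length) :=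
        hcond.to_comp.comp (hacc.pair (hi.pair ((hc.comp hi).pair
          (Computable.list_length.comp hl))))
      have hthen : Computable fun a : List ℕ × ℕ × List ℕ =>
          a.2.2 ++ [Ψ a.2.1 (a.1.take (c a.2.1))] :=
        Computable.list_concat.comp hacc (hΨ.comp hi
          (Primrec.list_take.to_comp.comp (hc.comp hi) hl))
      exact (Computable.cond hif hthen hacc).to₂
    · intro l
      simp only [ttOut, Bool.cond_decide]
  · intro l₁ l₂ hl
    exact (ttOut_prefix c Ψ hl _).trans (ttOut_mono c Ψ _ hl.length_le)
  · intro x hx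
    refine ⟨_, h x hx, fun n => ?_⟩
    refine ⟨n + 1 + ((List.range (n + 1)).map c).sum, ?_⟩
    set k := n + 1 + ((List.range (n + 1)).map c).sum with hk
    have h1 : ∀ i < n + 1, c i ≤ k := fun i hi => by
      have : c i ≤ ((List.range (n + 1)).map c).sum :=
        List.le_sum_of_mem (List.mem_map.2 ⟨i, by simpa using hi, rfl⟩)
      omega
    have h2 := ttOut_mono c Ψ (pref x k) (m := n + 1) (n := (pref x k).length)
      (by rw [pref_length]; omega)
    rw [ttOut_pref c Ψ x (n + 1) h1] at h2
    exact getElem?_eq_some_of_prefix h2 (pref_getElem? _ (Nat.lt_succ_self n))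

/-! ### Reductions between sets of configurations -/

theorem confFun_eq {k : ℕ} {A : Type*} [Encodable A] (z : FreeGroup (Fin k) → A)
    (n : ℕ) :
    confFun z n = ((Encodable.decode (α := List (Fin k × Bool)) n).map
      fun l => Encodable.encode (z (FreeGroup.mk l)) + 1).getD 0 := by
  have : Encodable.decode (α := FreeGroup (Fin k)) n =
      (Encodable.decode (α := List (Fin k × Bool)) n).map FreeGroup.mk := by
    change (Encodable.decode (α := List (Fin k × Bool)) n).bind _ = _
    cases Encodable.decode (α := List (Fin k × Bool)) n <;> rfl
  rw [confFun, this]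
  cases Encodable.decode (α := List (Fin k × Bool)) n <;> rfl

theorem confFun_encode {k : ℕ} {A : Type*} [Encodable A] (z : FreeGroup (Fin k) → A)
    (l : List (Fin k × Bool)) :
    confFun z (Encodable.encode l) = Encodable.encode (z (FreeGroup.mk l)) + 1 := by
  rw [confFun_eq, Encodable.encodek]
  rfl

theorem primrec_list_sum : Primrec (List.sum : List ℕ → ℕ) :=
  (Primrec.list_foldr (f := fun l : List ℕ => l) (g := fun _ => 0)
    (h := fun _ q => q.1 + q.2) Primrec.id (Primrec.const _)
    (Primrec.nat_add.comp (Primrec.fst.comp Primrec.snd) (Primrec.snd.comp Primrec.snd)).to₂).of_eq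
    fun _ => rfl

/-- Reading a point of `mSet Z` at the codes of finitely many translates of a computable word
transformation gives a Medvedev reduction. -/
theorem BaireLE.of_local {k m : ℕ} {A B : Type*} [Encodable A] [Encodable B]
    {Z : Set (FreeGroup (Fin k) → A)} {W : Set (FreeGroup (Fin m) → B)}
    (T : List (Fin m × Bool) → List (Fin k × Bool)) (D : List (List (Fin k × Bool)))
    (μ : List ℕ → ℕ) (hT : Computable T) (hμ : Computable μ)
    (h : ∀ z ∈ Z, ∃ w ∈ W, ∀ l, Encodable.encode (w (FreeGroup.mk l)) =
      μ (D.map fun d => Encodable.encode (z (FreeGroup.mk (T l ++ d))))) :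
    BaireLE (mSet W) (mSet Z) := by
  have hTd : Computable₂ fun (l : List (Fin m × Bool)) (d : List (Fin k × Bool)) =>
      Encodable.encode (T l ++ d) :=
    (Computable.encode.comp (Computable.list_append.comp (hT.comp Computable.fst)
      Computable.snd)).to₂
  have hc' : Computable fun l => (D.map fun d => Encodable.encode (T l ++ d)).sum + 1 :=
    Computable.succ.comp (primrec_list_sum.to_comp.comp
      (computable_list_map (Computable.const D) hTd))
  have hc : Computable fun n => ((Encodable.decode (α := List (Fin m × Bool)) n).map
      fun l => (D.map fun d => Encodable.encode (T l ++ d)).sum + 1).getD 0 :=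
    Computable.option_getD (Computable.option_map Computable.decode
      (hc'.comp Computable.snd).to₂) (Computable.const 0)
  have hread : Computable₂ fun (a : List (Fin m × Bool) × List ℕ) (d : List (Fin k × Bool)) =>
      a.2.getD (Encodable.encode (T a.1 ++ d)) 0 - 1 :=
    (Primrec.nat_sub.to_comp.comp ((Primrec.list_getD 0).to_comp.comp
      (Computable.snd.comp Computable.fst)
      (hTd.comp (Computable.fst.comp Computable.fst) Computable.snd))
      (Computable.const 1)).to₂
  have hval : Computable fun a : List (Fin m × Bool) × List ℕ =>
      μ (D.map fun d => a.2.getD (Encodable.encode (T a.1 ++ d)) 0 - 1) + 1 :=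
    Computable.succ.comp (hμ.comp (computable_list_map (Computable.const D) hread))
  have hΨ : Computable₂ fun (n : ℕ) (p : List ℕ) =>
      ((Encodable.decode (α := List (Fin m × Bool)) n).map
        fun l => μ (D.map fun d => p.getD (Encodable.encode (T l ++ d)) 0 - 1) + 1).getD 0 :=
    (Computable.option_getD (Computable.option_map
      (f := fun a : ℕ × List ℕ => Encodable.decode (α := List (Fin m × Bool)) a.1)
      (g := fun a l => μ (D.map fun d => a.2.getD (Encodable.encode (T l ++ d)) 0 - 1) + 1)
      (Computable.decode.comp Computable.fst)
      (hval.comp (Computable.snd.pair (Computable.snd.comp Computable.fst))).to₂)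
      (Computable.const 0)).to₂
  refine BaireLE.of_tt _ _ hc hΨ ?_
  rintro _ ⟨z, hz, rfl⟩
  obtain ⟨w, hw, hwz⟩ := h z hz
  refine ⟨w, hw, funext fun n => ?_⟩
  rw [confFun_eq]
  cases Encodable.decode (α := List (Fin m × Bool)) n with
  | none => rfl
  | some l =>
    simp only [Option.map_some, Option.getD_some, hwz]
    congr 2
    refine List.map_congr_left fun d hd => ?_
    rw [pref_getD, confFun_encode]
    · rfl
    · exact Nat.lt_succ_of_le (List.le_sum_of_mem (List.mem_map_of_mem hd))

/-! ### Change of generators -/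

theorem exists_wordVal_eq {G : Type*} [Group G] {k : ℕ} {σ : Fin k → G} (hσ : IsSymmGen σ)
    (g : G) : ∃ w, wordVal σ w = g := by
  have h : g ∈ (cover σ).range := by
    rw [cover, FreeGroup.range_lift_eq_closure, hσ.1]
    trivial
  obtain ⟨x, rfl⟩ := h
  exact ⟨x.toWord, by rw [wordVal, FreeGroup.mk_toWord]⟩

theorem wordVal_append {G : Type*} [Group G] {k : ℕ} (σ : Fin k → G)
    (u v : List (Fin k × Bool)) : wordVal σ (u ++ v) = wordVal σ u * wordVal σ v := by
  rw [wordVal, ← FreeGroup.mul_mk, map_mul]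
  rfl

theorem wordVal_nil {G : Type*} [Group G] {k : ℕ} (σ : Fin k → G) :
    wordVal σ [] = 1 := map_one (cover σ)

/-- Words over one generating family can be computably rewritten over another one. -/
theorem exists_computable_rewrite {K L : Type*} [Group K] [Group L] {k m : ℕ}
    (σ : Fin k → K) (θ : Fin m → L) {M : Type*} [Group M] (f : K →* M) (g : L →* M)
    (h : ∀ x : K, ∃ w, g (wordVal θ w) = f x) :
    ∃ T : List (Fin k × Bool) → List (Fin m × Bool), Computable T ∧
      ∀ l, g (wordVal θ (T l)) = f (wordVal σ l) := by
  choose t ht using fun a : Fin k × Bool => h (wordVal σ [a])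
  refine ⟨fun l => l.flatMap t, ?_, fun l => ?_⟩
  · exact (Primrec.list_flatMap Primrec.id ((Primrec.dom_finite t).comp Primrec.snd).to₂).to_comp
  · induction l with
    | nil => simp [wordVal_nil]
    | cons a l ih =>
      beta_reduce at ih ⊢
      rw [List.flatMap_cons, wordVal_append, map_mul, ht, ih, ← map_mul, ← wordVal_append]
      rfl

theorem pullback_medEquiv {G H : Type*} [Group G] [Group H] {k r : ℕ}
    {σ : Fin k → G} (hσ : IsSymmGen σ) {τ : Fin r → H} (hτ : IsSymmGen τ)
    {ρ : G →* H} (hρ : Function.Surjective ρ) {A : Type*} [Encodable A] (X : Set (H → A)) :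
    BaireEquiv (mSet (pullback (cover σ) (pullback ρ X))) (mSet (pullback (cover τ) X)) := by
  constructor
  · obtain ⟨T, hT, hval⟩ := exists_computable_rewrite σ τ ρ (MonoidHom.id H)
      fun x => exists_wordVal_eq hτ (ρ x)
    refine BaireLE.of_local T [[]] List.sum hT primrec_list_sum.to_comp ?_
    rintro _ ⟨x, hx, rfl⟩
    refine ⟨_, ⟨_, ⟨x, hx, rfl⟩, rfl⟩, fun l => ?_⟩
    have := hval l
    simp only [wordVal, MonoidHom.id_apply] at this
    simp [this]
  · obtain ⟨T, hT, hval⟩ := exists_computable_rewrite τ σ (MonoidHom.id H) ρ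
      fun x => (hρ x).elim fun g hg => (exists_wordVal_eq hσ g).imp fun w hw => by
        rw [hw, hg]; rfl
    refine BaireLE.of_local T [[]] List.sum hT primrec_list_sum.to_comp ?_
    rintro _ ⟨_, ⟨x, hx, rfl⟩, rfl⟩
    refine ⟨_, ⟨x, hx, rfl⟩, fun l => ?_⟩
    have := hval l
    simp only [wordVal, MonoidHom.id_apply] at this
    simp [this]

theorem BaireEquiv.trans {P Q R : Set (ℕ → ℕ)} (h₁ : BaireEquiv P Q) (h₂ : BaireEquiv Q R) :
    BaireEquiv P R := ⟨h₁.1.trans h₂.1, h₂.2.trans h₁.2⟩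

theorem isSoficDeg_of_isEffDeg {G H : Type*} [Group G] [Group H] {k r : ℕ}
    {σ : Fin k → G} (hσ : IsSymmGen σ) {τ : Fin r → H} (hτ : IsSymmGen τ)
    {ρ : G →* H} (hρ : Function.Surjective ρ)
    (hsim : ∀ (A : Type) [Finite A] [Encodable A] (X : Set (H → A)),
      IsSubshift X → IsEffective τ X → IsSofic (pullback ρ X))
    {P : Set (ℕ → ℕ)} (h : IsEffDeg τ P) : IsSoficDeg σ P := by
  obtain ⟨n, X, hX, heff, hne, hP⟩ := h
  exact ⟨n, pullback ρ X, hsim _ X hX heff, hne.image _,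
    (pullback_medEquiv hσ hτ hρ X).trans hP⟩

/-! ### Finite words over a finite list of letters -/

/-- All words of length `n` with letters in the list `A`. -/
def allWords {α : Type*} (A : List α) (n : ℕ) : List (List α) :=
  Nat.rec [[]] (fun _ W => W.flatMap fun w => A.map fun a => a :: w) n

theorem mem_allWords {α : Type*} {A : List α} {n : ℕ} {w : List α} :
    w ∈ allWords A n ↔ w.length = n ∧ ∀ a ∈ w, a ∈ A := by
  induction n generalizing w with
  | zero => simp [allWords]; aesop
  | succ n ih =>
    change w ∈ (allWords A n).flatMap _ ↔ _
    cases w with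
    | nil => simp
    | cons b w => simp [ih]; tauto

theorem primrec_allWords {α : Type*} [Primcodable α] (A : List α) : Primrec (allWords A) := by
  have h : Primrec fun q : (ℕ × ℕ × List (List α)) × List α =>
      A.map fun a => a :: q.2 :=
    Primrec.list_map (Primrec.const A)
      (Primrec.list_cons.comp Primrec.snd (Primrec.snd.comp Primrec.fst)).to₂
  exact Primrec.nat_rec' Primrec.id (Primrec.const [[]])
    (Primrec.list_flatMap (Primrec.snd.comp Primrec.snd) h.to₂).to₂

theorem computable_list_all {α β : Type*} [Primcodable α] [Primcodable β]
    {f : α → List β} {p : α → β → Bool} (hf : Computable f) (hp : Computable₂ p) :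
    Computable fun a => (f a).all (p a) := by
  refine (Primrec.not.to_comp.comp (computable_list_any hf
    (Primrec.not.to_comp.comp hp).to₂)).of_eq fun a => ?_
  simp [List.not_any_eq_all_not]

/-! ### Diagonally noncomputable functions with values in `{0, 1}` -/

/-- The set of `{0, 1}`-valued diagonally noncomputable functions. -/
def dnc : Set (ℕ → ℕ) :=
  {x | x ∈ cantorSpace ∧
    ∀ e v, v ∈ (Denumerable.ofNat Nat.Partrec.Code e).eval e → x e ≠ v}

theorem dnc_nonempty : dnc.Nonempty := by
  classical
  refine ⟨fun e => if 0 ∈ (Denumerable.ofNat Nat.Partrec.Code e).eval e then 1 else 0,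
    fun e => ?_, fun e v hv => ?_⟩
  · dsimp only
    split_ifs <;> omega
  · dsimp only
    split_ifs with h
    · rw [Part.mem_unique hv h]
      exact one_ne_zero
    · rintro rfl
      exact h hv

theorem mem_cylinder_append_singleton {x : ℕ → ℕ} {w : List ℕ} {v : ℕ} :
    x ∈ cylinder (w ++ [v]) ↔ pref x w.length = w ∧ x w.length = v := by
  rw [← pref_prefix_iff, List.length_append, List.length_singleton, pref_succ]
  constructor
  · intro h
    have h1 := List.append_inj (h.eq_of_length (by simp [pref_length])) (pref_length _ _).symm
    exact ⟨h1.1.symm, (List.singleton_inj.1 h1.2).symm⟩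
  · rintro ⟨h1, h2⟩
    rw [h1, h2]

theorem dnc_isPi01Cantor : IsPi01Cantor dnc := by
  have hp : Primrec fun q : ℕ × List ℕ × ℕ =>
      (if Nat.Partrec.Code.evaln q.1 (Denumerable.ofNat Nat.Partrec.Code q.2.1.length)
        q.2.1.length = some q.2.2 then q.2.1 ++ [q.2.2] else [2] : List ℕ) := by
    have hlen : Primrec fun q : ℕ × List ℕ × ℕ => q.2.1.length :=
      Primrec.list_length.comp (Primrec.fst.comp Primrec.snd)
    refine Primrec.ite (Primrec.eq.comp (Nat.Partrec.Code.primrec_evaln.comp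
      ((Primrec.fst.pair ((Primrec.ofNat _).comp hlen)).pair hlen))
      (Primrec.option_some.comp (Primrec.snd.comp Primrec.snd))) ?_ (Primrec.const _)
    exact Primrec.list_concat.comp (Primrec.fst.comp Primrec.snd) (Primrec.snd.comp Primrec.snd)
  refine ⟨_, (hp.comp (Primrec.ofNat (ℕ × List ℕ × ℕ))).to_comp, ?_⟩
  ext x
  simp only [dnc, Set.mem_sdiff, Set.mem_iUnion, not_exists]
  refine and_congr_right fun hx => ⟨fun h n hn => ?_, fun h e v hv hxe => ?_⟩
  · generalize Denumerable.ofNat (ℕ × List ℕ × ℕ) n = q at hn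
    obtain ⟨s, w, v⟩ := q
    dsimp only at hn
    split_ifs at hn with hev
    · obtain ⟨-, hv⟩ := mem_cylinder_append_singleton.1 hn
      exact h _ _ (Nat.Partrec.Code.evaln_sound hev) hv
    · have h2 := hn 0 (by simp)
      have := hx 0
      simp at h2
      omega
  · obtain ⟨s, hs⟩ := Nat.Partrec.Code.evaln_complete.1 hv
    refine h (Encodable.encode (s, pref x e, v)) ?_
    rw [Denumerable.ofNat_encode]
    dsimp only
    rw [pref_length, if_pos (Option.mem_def.1 hs), mem_cylinder_append_singleton, pref_length]
    exact ⟨rfl, hxe⟩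

theorem isCompact_cantorSpace_inter_cylinder (u : List ℕ) :
    IsCompact (cantorSpace ∩ cylinder u) := by
  have h1 : IsCompact cantorSpace := by
    have : cantorSpace = Set.univ.pi fun _ => Set.Iic 1 := by
      ext x; simp [cantorSpace, Pi.le_def]
    rw [this]
    exact isCompact_univ_pi fun _ => (Set.finite_Iic 1).isCompact
  refine h1.inter_right ?_
  have : cylinder u = ⋂ (i : ℕ) (h : i < u.length), (fun x : ℕ → ℕ => x i) ⁻¹' {u[i]} := by
    ext x; simp [cylinder]
  rw [this]
  exact isClosed_iInter fun i => isClosed_iInter fun h =>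
    (isClosed_discrete _).preimage (continuous_apply i)

theorem isOpen_cylinder (u : List ℕ) : IsOpen (cylinder u) := by
  have : cylinder u = ⋂ i : Fin u.length, (fun x : ℕ → ℕ => x i) ⁻¹' {u[i]} := by
    ext x; simp [cylinder, Fin.forall_iff]
  rw [this]
  exact isOpen_iInter_of_finite fun i => (isOpen_discrete _).preimage (continuous_apply _)

/-- `u` is seen to be non-extendible to a point of `cantorSpace \ ⋃ n, cylinder (f n)` by
inspecting its extensions by `t` bits. -/
def dead (f : ℕ → List ℕ) (t : ℕ) (u : List ℕ) : Bool :=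
  (allWords [0, 1] t).all fun v => (List.range t).any fun n => (f n).isPrefixOf (u ++ v)

theorem computable_isPrefixOf : Computable₂ fun l₁ l₂ : List ℕ => l₁.isPrefixOf l₂ := by
  have h : Primrec fun q : List ℕ × List ℕ => decide (q.1 = q.2.take q.1.length) :=
    (Primrec.eq.comp Primrec.fst (Primrec.list_take.comp (Primrec.list_length.comp Primrec.fst)
      Primrec.snd)).decide
  refine Computable.to₂ (f := fun q : List ℕ × List ℕ => q.1.isPrefixOf q.2) ?_
  refine h.to_comp.of_eq fun q => ?_
  rw [Bool.eq_iff_iff, decide_eq_true_iff, List.isPrefixOf_iff_prefix, List.prefix_iff_eq_take]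

theorem computable_dead {f : ℕ → List ℕ} (hf : Computable f) : Computable₂ (dead f) := by
  have h1 : Computable₂ fun (a : (ℕ × List ℕ) × List ℕ) (n : ℕ) =>
      (f n).isPrefixOf (a.1.2 ++ a.2) :=
    (computable_isPrefixOf.comp (hf.comp Computable.snd) (Computable.list_append.comp
      (Computable.snd.comp (Computable.fst.comp Computable.fst))
      (Computable.snd.comp Computable.fst))).to₂
  have h2 : Computable fun a : (ℕ × List ℕ) × List ℕ =>
      (List.range a.1.1).any fun n => (f n).isPrefixOf (a.1.2 ++ a.2) :=
    computable_list_any (Primrec.list_range.to_comp.comp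
      (Computable.fst.comp Computable.fst)) h1
  exact (computable_list_all ((primrec_allWords [0, 1]).to_comp.comp Computable.fst) h2.to₂).to₂

theorem dead_sound {f : ℕ → List ℕ} {t : ℕ} {u : List ℕ} (h : dead f t u = true) {x : ℕ → ℕ}
    (hx : x ∈ cantorSpace) (hu : x ∈ cylinder u) : ∃ n, x ∈ cylinder (f n) := by
  simp only [dead, List.all_eq_true, List.any_eq_true, List.isPrefixOf_iff_prefix] at h
  obtain ⟨n, -, hn⟩ := h ((List.range t).map fun i => x (u.length + i))
    (mem_allWords.2 ⟨by simp, by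
      intro a ha
      obtain ⟨i, -, rfl⟩ := List.mem_map.1 ha
      have := hx (u.length + i)
      simp
      omega⟩)
  refine ⟨n, (pref_prefix_iff x _).1 ?_⟩
  have h1 : pref x (u.length + t) = u ++ (List.range t).map fun i => x (u.length + i) := by
    have := ((pref_prefix_iff x u).2 hu).eq_of_length (by simp [pref_length])
    conv_rhs => rw [this]
    simp [pref, List.range_add]
  rw [← h1] at hn
  have h2 := hn.length_le
  rw [pref_length] at h2
  rw [← pref_take x h2]
  exact (List.prefix_iff_eq_take.1 hn) ▸ List.prefix_rfl

theorem dead_complete {f : ℕ → List ℕ} {u : List ℕ} (hu : ∀ a ∈ u, a ≤ 1)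
    (h : ∀ x ∈ cantorSpace, x ∈ cylinder u → ∃ n, x ∈ cylinder (f n)) :
    ∃ t, dead f t u = true := by
  obtain ⟨s, hs⟩ := (isCompact_cantorSpace_inter_cylinder u).elim_finite_subcover
    (fun n => cylinder (f n)) (fun n => isOpen_cylinder _)
    (fun x hx => Set.mem_iUnion.2 (h x hx.1 hx.2))
  refine ⟨∑ n ∈ s, (n + 1 + (f n).length), ?_⟩
  simp only [dead, List.all_eq_true, List.any_eq_true, List.isPrefixOf_iff_prefix]
  intro v hv
  obtain ⟨hlen, hv⟩ := mem_allWords.1 hv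
  let x : ℕ → ℕ := fun i => (u ++ v).getD i 0
  have hx1 : x ∈ cantorSpace := by
    intro i
    by_cases hi : i < (u ++ v).length
    · simp only [x, List.getD_eq_getElem _ _ hi]
      rcases List.mem_append.1 (List.getElem_mem hi) with h' | h'
      · exact hu _ h'
      · have := hv _ h'
        simp at this
        omega
    · simp only [x, List.getD_eq_default _ _ (not_lt.1 hi)]
      omega
  have hx2 : x ∈ cylinder u := by
    intro i hi
    simp only [x]
    rw [List.getD_append _ _ _ _ hi, List.getD_eq_getElem _ _ hi]
  obtain ⟨n, hns, hn⟩ := Set.mem_iUnion₂.1 (hs ⟨hx1, hx2⟩)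
  have hle : n + 1 + (f n).length ≤ ∑ n ∈ s, (n + 1 + (f n).length) :=
    Finset.single_le_sum (f := fun n => n + 1 + (f n).length) (fun _ _ => Nat.zero_le _) hns
  refine ⟨n, List.mem_range.2 (by omega), ?_⟩
  have hl : (f n).length ≤ (u ++ v).length := by
    rw [List.length_append]
    omega
  have hpx : pref x (u ++ v).length = u ++ v := by
    apply List.ext_getElem
    · simp [pref_length]
    · intro i h1 h2
      simp only [pref, List.getElem_map, List.getElem_range, x, List.getD_eq_getElem _ _ h2]
  rw [← hpx]
  exact ((pref_prefix_iff x _).2 hn).trans (pref_prefix x hl)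

/-- A uniformly computable family of indices at which diagonal noncomputability separates the
two one-bit extensions of a word. -/
theorem exists_extension_index {f : ℕ → List ℕ} (hf : Computable f) :
    ∃ e : List ℕ → ℕ, Primrec e ∧ ∀ x ∈ dnc, ∀ s : List ℕ, (∀ a ∈ s, a ≤ 1) →
      (∃ y ∈ cantorSpace \ ⋃ n, cylinder (f n), y ∈ cylinder s) →
      ∃ y ∈ cantorSpace \ ⋃ n, cylinder (f n), y ∈ cylinder (s ++ [x (e s)]) := by
  have happ : ∀ b, Computable₂ fun (s : List ℕ) (t : ℕ) => dead f t (s ++ [b]) := fun b =>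
    ((computable_dead hf).comp Computable.snd (Computable.list_concat.comp Computable.fst
      (Computable.const b))).to₂
  have hor : Computable₂ fun (s : List ℕ) (t : ℕ) =>
      dead f t (s ++ [0]) || dead f t (s ++ [1]) :=
    (Primrec.or.to_comp.comp (happ 0) (happ 1)).to₂
  have hval : Computable₂ fun (s : List ℕ) (t : ℕ) =>
      bif dead f t (s ++ [0]) then 0 else 1 :=
    (Computable.cond (happ 0) (Computable.const 0) (Computable.const 1)).to₂
  have hψ : Partrec fun s : List ℕ => (Nat.rfind fun t =>
      (Part.some (dead f t (s ++ [0]) || dead f t (s ++ [1])))).map fun t =>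
        bif dead f t (s ++ [0]) then 0 else 1 :=
    (Partrec.rfind hor.partrec₂).map hval
  set ψ : List ℕ →. ℕ := fun s => (Nat.rfind fun t =>
      (Part.some (dead f t (s ++ [0]) || dead f t (s ++ [1])))).map fun t =>
        bif dead f t (s ++ [0]) then 0 else 1
  have hψspec : ∀ s v, v ∈ ψ s → ∃ t, dead f t (s ++ [v]) = true := by
    intro s v hv
    obtain ⟨t, ht, rfl⟩ := (Part.mem_map_iff _).1 hv
    have := (Nat.mem_rfind.1 ht).1
    refine ⟨t, ?_⟩
    cases h0 : dead f t (s ++ [0])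
    · simpa [h0] using this
    · simpa using h0
  have hψdom : ∀ s b t, b ≤ 1 → dead f t (s ++ [b]) = true → ∃ v, v ∈ ψ s := by
    intro s b t hb hd
    have : (Nat.rfind fun t =>
      (Part.some (dead f t (s ++ [0]) || dead f t (s ++ [1])) : Part Bool)).Dom := by
      refine Nat.rfind_dom.2 ⟨t, ?_, fun _ => trivial⟩
      rw [Part.mem_some_iff]
      interval_cases b <;> simp [hd]
    exact ⟨_, Part.mem_map _ (Part.get_mem this)⟩
  obtain ⟨c, hc⟩ := Nat.Partrec.Code.exists_code.1 (Partrec.nat_iff.1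
    (hψ.comp ((Primrec.ofNat (List ℕ)).comp (Primrec.fst.comp Primrec.unpair)).to_comp))
  refine ⟨fun s => Encodable.encode (Nat.Partrec.Code.curry c (Encodable.encode s)),
    Primrec.encode.comp (Nat.Partrec.Code.primrec₂_curry.comp (Primrec.const c)
      Primrec.encode), ?_⟩
  intro x hx s hs ⟨y, hy, hys⟩
  set e := Encodable.encode (Nat.Partrec.Code.curry c (Encodable.encode s)) with he
  have heval : (Denumerable.ofNat Nat.Partrec.Code e).eval e = ψ s := by
    rw [he, Denumerable.ofNat_encode, Nat.Partrec.Code.eval_curry, hc]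
    simp
  by_contra hcon
  push Not at hcon
  have hsb : ∀ b ≤ 1, ∀ a ∈ s ++ [b], a ≤ 1 := by
    intro b hb a ha
    rcases List.mem_append.1 ha with h | h
    · exact hs a h
    · rw [List.mem_singleton.1 h]
      exact hb
  obtain ⟨t, ht⟩ := dead_complete (f := f) (hsb _ (hx.1 e)) fun z hz hzu => by
    by_contra hn
    exact hcon z ⟨hz, by simpa using hn⟩ hzu
  obtain ⟨v, hv⟩ := hψdom s _ t (hx.1 e) ht
  obtain ⟨t', ht'⟩ := hψspec s v hv
  have hne : x e ≠ v := hx.2 e v (heval ▸ hv)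
  have hyn : y s.length ≠ v := fun hyv => by
    obtain ⟨n, hn⟩ := dead_sound ht' hy.1 (mem_cylinder_append_singleton.2
      ⟨(((pref_prefix_iff y s).2 hys).eq_of_length (by simp [pref_length])).symm, hyv⟩)
    exact hy.2 (Set.mem_iUnion.2 ⟨n, hn⟩)
  have hv1 : v ≤ 1 := by
    obtain ⟨t, -, rfl⟩ := (Part.mem_map_iff _).1 hv
    cases dead f t (s ++ [0]) <;> simp
  have hyx : y s.length = x e := by
    have := hx.1 e
    have := hy.1 s.length
    omega
  exact hcon y hy (mem_cylinder_append_singleton.2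
    ⟨(((pref_prefix_iff y s).2 hys).eq_of_length (by simp [pref_length])).symm, hyx⟩)

/-- The word obtained by querying `g` along the path determined by the previous answers. -/
def queryPath (e : List ℕ → ℕ) (g : ℕ → ℕ) (n : ℕ) : List ℕ :=
  Nat.rec [] (fun _ s => s ++ [g (e s)]) n

theorem queryPath_succ (e : List ℕ → ℕ) (g : ℕ → ℕ) (n : ℕ) :
    queryPath e g (n + 1) = queryPath e g n ++ [g (e (queryPath e g n))] := rfl

theorem dnc_maximal {Q : Set (ℕ → ℕ)} (hQ : IsPi01Cantor Q) (hne : Q.Nonempty) :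
    BaireLE Q dnc := by
  obtain ⟨f, hf, rfl⟩ := hQ
  obtain ⟨e, he, hext⟩ := exists_extension_index hf
  let c : ℕ → ℕ := fun n =>
    (((List.range (n + 1)).flatMap (allWords [0, 1])).map e).sum + 1
  have hc : Primrec c := Primrec.succ.comp (primrec_list_sum.comp (Primrec.list_map
    (Primrec.list_flatMap (Primrec.list_range.comp Primrec.succ)
      ((primrec_allWords [0, 1]).comp Primrec.snd).to₂) (he.comp Primrec.snd).to₂))
  have hget : Primrec fun q : List ℕ × List ℕ => q.1.getD (e q.2) 0 :=
    (Primrec.list_getD 0).comp Primrec.fst (he.comp Primrec.snd)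
  have hpath : Primrec fun a : ℕ × List ℕ => queryPath e (fun i => a.2.getD i 0) a.1 := by
    have hstep : Primrec fun q : (ℕ × List ℕ) × ℕ × List ℕ =>
        q.2.2 ++ [q.1.2.getD (e q.2.2) 0] :=
      Primrec.list_concat.comp (Primrec.snd.comp Primrec.snd)
        (hget.comp ((Primrec.snd.comp Primrec.fst).pair (Primrec.snd.comp Primrec.snd)))
    exact Primrec.nat_rec' Primrec.fst (Primrec.const []) hstep.to₂
  refine BaireLE.of_tt c (fun n p => p.getD (e (queryPath e (fun i => p.getD i 0) n)) 0)
    hc.to_comp (hget.comp (Primrec.snd.pair hpath)).to_comp.to₂ fun x hx => ?_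
  have hbin : ∀ n, (queryPath e x n).length = n ∧ ∀ a ∈ queryPath e x n, a ≤ 1 := by
    intro n
    induction n with
    | zero => simp [queryPath]
    | succ n ih =>
      rw [queryPath_succ]
      refine ⟨by simp [ih.1], fun a ha => ?_⟩
      rcases List.mem_append.1 ha with h | h
      · exact ih.2 a h
      · rw [List.mem_singleton.1 h]
        exact hx.1 _
  have hbound : ∀ n, ∀ k ≤ n, e (queryPath e x k) < c n := by
    intro n k hk
    refine Nat.lt_succ_of_le (List.le_sum_of_mem (List.mem_map_of_mem ?_))
    refine List.mem_flatMap.2 ⟨k, List.mem_range.2 (by omega), mem_allWords.2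
      ⟨(hbin k).1, fun a ha => ?_⟩⟩
    have := (hbin k).2 a ha
    simp
    omega
  have hagree : ∀ n, ∀ k ≤ n,
      queryPath e (fun i => (pref x (c n)).getD i 0) k = queryPath e x k := by
    intro n k
    induction k with
    | zero => intro _; rfl
    | succ k ih =>
      intro hk
      rw [queryPath_succ, queryPath_succ, ih (by omega), pref_getD x (hbound n k (by omega))]
  have hfun : (fun n => (pref x (c n)).getD
      (e (queryPath e (fun i => (pref x (c n)).getD i 0) n)) 0) =
      fun n => x (e (queryPath e x n)) := by
    funext n
    rw [hagree n n le_rfl, pref_getD x (hbound n n le_rfl)]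
  rw [hfun]
  have hpref : ∀ n, pref (fun n => x (e (queryPath e x n))) n = queryPath e x n := by
    intro n
    induction n with
    | zero => rfl
    | succ n ih => rw [pref_succ, ih, queryPath_succ]
  have hextn : ∀ n, ∃ y ∈ cantorSpace \ ⋃ n, cylinder (f n), y ∈ cylinder (queryPath e x n) := by
    intro n
    induction n with
    | zero =>
      obtain ⟨y, hy⟩ := hne
      exact ⟨y, hy, fun i hi => absurd hi (Nat.not_lt_zero i)⟩
    | succ n ih => exact hext x hx _ (hbin n).2 ih
  refine ⟨fun n => hx.1 _, fun hmem => ?_⟩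
  obtain ⟨m, hm⟩ := Set.mem_iUnion.1 hmem
  obtain ⟨y, hy, hym⟩ := hextn (f m).length
  have h1 := (pref_prefix_iff _ _).2 hm
  rw [hpref] at h1
  rw [← h1.eq_of_length (hbin _).1.symm] at hym
  exact hy.2 (Set.mem_iUnion.2 ⟨m, hym⟩)

theorem dnc_isMaxPi01 : IsMaxPi01 dnc :=
  ⟨dnc_isPi01Cantor, dnc_nonempty, fun _ hQ hne => dnc_maximal hQ hne⟩

/-! ### Sofic subshifts are computed by subshifts of finite type -/

theorem primrec_of_finite_support {α : Type*} [Primcodable α] (S : Finset α) (μ : α → ℕ)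
    (h : ∀ x ∉ S, μ x = 0) : Primrec μ := by
  classical
  induction S using Finset.induction_on generalizing μ with
  | empty =>
    rw [show μ = fun _ => 0 from funext fun x => h x (Finset.notMem_empty x)]
    exact Primrec.const 0
  | insert a S _ ih =>
    have h1 : Primrec (Function.update μ a 0) := ih _ fun x hx => by
      by_cases hxa : x = a
      · rw [hxa, Function.update_self]
      · rw [Function.update_of_ne hxa]
        exact h x (by simp [hxa, hx])
    refine (Primrec.ite (Primrec.eq.comp Primrec.id (Primrec.const a))
      (Primrec.const (μ a)) h1).of_eq fun x => ?_
    by_cases hxa : x = a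
    · simp [hxa]
    · simp [hxa]

theorem IsSFT.isClosed {G A : Type*} [Group G] {X : Set (G → A)} (h : IsSFT X) :
    @IsClosed (G → A) (prodiscrete G A) X := by
  let _ : TopologicalSpace A := ⊥
  have _ : DiscreteTopology A := ⟨rfl⟩
  change IsClosed X
  obtain ⟨F, rfl⟩ := h
  have hset : {x : G → A | ∀ p ∈ F, ∀ g : G, ¬MatchesAt p g x} =
      ⋂ (p) (_ : p ∈ F) (g : G), (⋂ h : {g' // g' ∈ p.dom},
        {x : G → A | x (g⁻¹ * h) = p.val h})ᶜ := by
    ext x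
    simp [MatchesAt, shift]
  rw [hset]
  refine isClosed_iInter fun p => isClosed_iInter fun _ => isClosed_iInter fun g => ?_
  rw [isClosed_compl_iff]
  exact isOpen_iInter_of_finite fun h =>
    (isOpen_discrete {p.val h}).preimage
      (f := fun x : G → A => x (g⁻¹ * (h : G))) (continuous_apply _)

/-- A continuous map on a closed set of configurations over a finite alphabet has finite
memory at the identity. -/
theorem exists_finite_memory {G A B : Type*} [Group G] [Finite B] {Y : Set (G → B)}
    (hY : @IsClosed (G → B) (prodiscrete G B) Y) {φ : (G → B) → (G → A)}
    (hφ : @ContinuousOn (G → B) (G → A) (prodiscrete G B) (prodiscrete G A) φ Y) :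
    ∃ D : Finset G, ∀ y ∈ Y, ∀ y' ∈ Y, (∀ d ∈ D, y d = y' d) → φ y 1 = φ y' 1 := by
  classical
  let _ : TopologicalSpace A := ⊥
  have _ : DiscreteTopology A := ⟨rfl⟩
  let _ : TopologicalSpace B := ⊥
  have _ : DiscreteTopology B := ⟨rfl⟩
  change IsClosed Y at hY
  change ContinuousOn φ Y at hφ
  have hloc : ∀ y ∈ Y, ∃ D : Finset G, ∀ y' ∈ Y, (∀ d ∈ D, y' d = y d) → φ y' 1 = φ y 1 := by
    intro y hy
    have h1 : ContinuousOn (fun y => φ y 1) Y := (continuous_apply 1).comp_continuousOn hφ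
    have h2 := (h1 y hy).preimage_mem_nhdsWithin ((isOpen_discrete {φ y 1}).mem_nhds rfl)
    obtain ⟨U, hU, hyU, hsub⟩ := mem_nhdsWithin.1 h2
    obtain ⟨I, u, hu, huU⟩ := isOpen_pi_iff.1 hU y hyU
    refine ⟨I, fun y' hy' hd => hsub ⟨huU fun d hdI => ?_, hy'⟩⟩
    rw [hd d hdI]
    exact (hu d hdI).2
  choose! D hD using hloc
  have hopen : ∀ y, IsOpen {y' : G → B | ∀ d ∈ D y, y' d = y d} := by
    intro y
    have : {y' : G → B | ∀ d ∈ D y, y' d = y d} = (D y : Set G).pi fun d => {y d} := by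
      ext; simp [Set.mem_pi]
    rw [this]
    exact isOpen_set_pi (D y).finite_toSet fun d _ => isOpen_discrete _
  obtain ⟨t, htY, ht⟩ := hY.isCompact.elim_nhds_subcover
    (fun y => {y' | ∀ d ∈ D y, y' d = y d}) fun y _ => (hopen y).mem_nhds fun _ _ => rfl
  refine ⟨t.biUnion D, fun y hy y' hy' h => ?_⟩
  obtain ⟨y₀, hy₀, hyd⟩ := Set.mem_iUnion₂.1 (ht hy)
  rw [hD y₀ (htY _ hy₀) y hy hyd, hD y₀ (htY _ hy₀) y' hy' fun d hd => ?_]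
  rw [← h d (Finset.mem_biUnion.2 ⟨y₀, hy₀, hd⟩)]
  exact hyd d hd

theorem IsSofic.exists_isSFT {G : Type*} [Group G] {k : ℕ} {σ : Fin k → G}
    (hσ : IsSymmGen σ) {A : Type*} [Encodable A] {X : Set (G → A)} (hX : IsSofic X)
    (hne : X.Nonempty) :
    ∃ (n : ℕ) (Y : Set (G → Fin n)), IsSFT Y ∧ Y.Nonempty ∧
      BaireLE (mSet (pullback (cover σ) X)) (mSet (pullback (cover σ) Y)) := by
  classical
  obtain ⟨B, hB, Y, φ, hSFT, ⟨hmaps, hcont, hequi⟩, rfl⟩ := hX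
  obtain ⟨n, ⟨e⟩⟩ := Finite.exists_equiv_fin B
  have hclosed := hSFT.isClosed
  obtain ⟨D, hD⟩ := exists_finite_memory hclosed hcont
  choose w hw using fun g : G => exists_wordVal_eq hσ g
  let L : (G → B) → List ℕ := fun y => D.toList.map fun d => Encodable.encode (e (y d))
  have hfin : (L '' Y).Finite := by
    refine ((List.finite_length_eq (Fin n) D.toList.length).image
      (List.map Encodable.encode)).subset ?_
    rintro _ ⟨y, -, rfl⟩
    exact ⟨D.toList.map fun d => e (y d), by simp, by simp [L]⟩
  let μ : List ℕ → ℕ := fun s =>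
    if h : ∃ y ∈ Y, L y = s then Encodable.encode (φ h.choose 1) else 0
  have hμ : ∀ y ∈ Y, μ (L y) = Encodable.encode (φ y 1) := by
    intro y hy
    have h : ∃ y' ∈ Y, L y' = L y := ⟨y, hy, rfl⟩
    simp only [μ, dif_pos h]
    congr 1
    refine hD _ h.choose_spec.1 _ hy fun d hd => ?_
    have := List.map_inj_left.1 h.choose_spec.2 d (Finset.mem_toList.2 hd)
    exact e.injective (Encodable.encode_injective this)
  have hμc : Computable μ := by
    refine (primrec_of_finite_support hfin.toFinset μ fun s hs => dif_neg ?_).to_comp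
    rintro ⟨y, hy, rfl⟩
    exact hs (hfin.mem_toFinset.2 ⟨y, hy, rfl⟩)
  refine ⟨n, {y | e.symm ∘ y ∈ Y}, ?_, ?_, ?_⟩
  · obtain ⟨F, rfl⟩ := hSFT
    refine ⟨F.map fun p => ⟨p.dom, e ∘ p.val⟩, ?_⟩
    ext y
    simp only [Set.mem_ofPred_eq, List.mem_map, forall_exists_index, and_imp,
      forall_apply_eq_imp_iff₂]
    refine forall₃_congr fun p _ g => not_congr ?_
    simp [MatchesAt, shift, Equiv.symm_apply_eq]
  · obtain ⟨_, y, hy, rfl⟩ := hne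
    refine ⟨e ∘ y, ?_⟩
    simpa [← Function.comp_assoc] using hy
  · refine BaireLE.of_local id (D.toList.map w) μ Computable.id hμc ?_
    rintro _ ⟨y, hy, rfl⟩
    refine ⟨_, ⟨_, ⟨e.symm ∘ y, hy, rfl⟩, rfl⟩, fun l => ?_⟩
    have hshift : shift (wordVal σ l)⁻¹ (e.symm ∘ y) ∈ Y := by
      obtain ⟨F, rfl⟩ := hSFT
      intro p hp g hm
      refine hy p hp (g * (wordVal σ l)⁻¹) fun h => ?_
      have := hm h
      simpa [shift, mul_assoc] using this
    have h1 := hμ _ hshift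
    rw [hequi _ hy] at h1
    have h2 : L (shift (wordVal σ l)⁻¹ (e.symm ∘ y)) =
        (D.toList.map w).map fun d =>
          Encodable.encode ((y ∘ cover σ) (FreeGroup.mk (id l ++ d))) := by
      rw [List.map_map]
      refine List.map_congr_left fun d _ => ?_
      have h3 : cover σ (FreeGroup.mk (l ++ w d)) = wordVal σ l * d := by
        have := wordVal_append σ l (w d)
        rwa [hw] at this
      simp [shift, h3]
    rw [← h2, h1]
    simp [shift, wordVal]

/-! ### A self-synchronizing coding of a binary sequence -/

theorem primrec_two_pow : Primrec fun n : ℕ => 2 ^ n := by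
  have h : Primrec fun q : ℕ × ℕ × ℕ => q.2.2 * 2 :=
    Primrec.nat_mul.comp (Primrec.snd.comp Primrec.snd) (Primrec.const 2)
  refine (Primrec.nat_rec' (f := fun n : ℕ => n) (g := fun _ => 1)
    (h := fun _ q => q.2 * 2) Primrec.id (Primrec.const 1) h.to₂).of_eq fun n => ?_
  induction n with
  | zero => rfl
  | succ n ih => rw [pow_succ, ← ih]

/-- The exponent of `2` in a positive integer. -/
def val2 (N : ℕ) : ℕ := Nat.findGreatest (fun j => N % 2 ^ j = 0) N

theorem primrec_val2 : Primrec val2 := by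
  have h : PrimrecRel fun N j : ℕ => N % 2 ^ j = 0 :=
    Primrec.eq.comp (Primrec.nat_mod.comp Primrec.fst (primrec_two_pow.comp Primrec.snd))
      (Primrec.const 0)
  exact Primrec.nat_findGreatest Primrec.id h

theorem val2_le (N : ℕ) : val2 N ≤ N := Nat.findGreatest_le N

theorem val2_eq {N j q : ℕ} (h : N = 2 ^ j * (2 * q + 1)) : val2 N = j := by
  rw [val2, Nat.findGreatest_eq_iff]
  have hj : j < 2 ^ j := Nat.lt_two_pow_self
  refine ⟨?_, fun _ => ?_, fun i hi _ hmod => ?_⟩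
  · rw [h]
    nlinarith
  · rw [h]
    exact Nat.mul_mod_right _ _
  · have h1 : 2 ^ (j + 1) ∣ 2 ^ j * (2 * q + 1) :=
      (pow_dvd_pow 2 hi).trans (h ▸ Nat.dvd_of_mod_eq_zero hmod)
    rw [pow_succ] at h1
    have h2 := Nat.dvd_of_mul_dvd_mul_left (by positivity) h1
    omega

/-- The letter at distance `N` from the identity coding the binary sequence `x`: it records `N`
modulo `3`, the parity of the exponent `val2 (N + 1)`, and the bit of `x` at that exponent. -/
def letterAt (x : ℕ → ℕ) (N : ℕ) : ℕ :=
  N % 3 + 3 * (val2 (N + 1) % 2) + 6 * x (val2 (N + 1))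

theorem letterAt_lt {x : ℕ → ℕ} (hx : x ∈ cantorSpace) (N : ℕ) : letterAt x N < 12 := by
  have := hx (val2 (N + 1))
  simp only [letterAt]
  omega

theorem letterAt_mod {x : ℕ → ℕ} (N : ℕ) : letterAt x N % 3 = N % 3 := by
  simp only [letterAt]
  omega

theorem letterAt_tag {x : ℕ → ℕ} (N : ℕ) : letterAt x N / 3 % 2 = val2 (N + 1) % 2 := by
  simp only [letterAt]
  omega

theorem letterAt_bit {x : ℕ → ℕ} (hx : x ∈ cantorSpace) (N : ℕ) :
    letterAt x N / 6 % 2 = x (val2 (N + 1)) := by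
  have := hx (val2 (N + 1))
  simp only [letterAt]
  omega

/-- The position, in a window of consecutive letters, synchronized modulo `2 ^ j`. -/
def syncPos (L : List ℕ) (j : ℕ) : ℕ :=
  Nat.rec 0 (fun j a =>
    if L.getD a 0 / 3 % 2 = j % 2 ∧ L.getD (a + 2 * 2 ^ j) 0 / 3 % 2 = j % 2 then a + 2 ^ j
    else a) j

theorem syncPos_succ (L : List ℕ) (j : ℕ) : syncPos L (j + 1) =
    if L.getD (syncPos L j) 0 / 3 % 2 = j % 2 ∧
      L.getD (syncPos L j + 2 * 2 ^ j) 0 / 3 % 2 = j % 2 then syncPos L j + 2 ^ j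
    else syncPos L j := rfl

/-- The bit of index `i` decoded from a window of consecutive letters. -/
def decodeBit (L : List ℕ) (i : ℕ) : ℕ := L.getD (syncPos L (i + 1) + 2 ^ i) 0 / 6 % 2

theorem primrec_syncPos : Primrec₂ syncPos := by
  have htag : Primrec fun q : List ℕ × ℕ => q.1.getD q.2 0 / 3 % 2 :=
    Primrec.nat_mod.comp (Primrec.nat_div.comp
      ((Primrec.list_getD 0).comp Primrec.fst Primrec.snd) (Primrec.const 3)) (Primrec.const 2)
  have hL : Primrec fun q : (List ℕ × ℕ) × ℕ × ℕ => q.1.1 := Primrec.fst.comp Primrec.fst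
  have hj : Primrec fun q : (List ℕ × ℕ) × ℕ × ℕ => q.2.1 := Primrec.fst.comp Primrec.snd
  have ha : Primrec fun q : (List ℕ × ℕ) × ℕ × ℕ => q.2.2 := Primrec.snd.comp Primrec.snd
  have hj2 : Primrec fun q : (List ℕ × ℕ) × ℕ × ℕ => q.2.1 % 2 :=
    Primrec.nat_mod.comp hj (Primrec.const 2)
  have hpow : Primrec fun q : (List ℕ × ℕ) × ℕ × ℕ => 2 ^ q.2.1 := primrec_two_pow.comp hj
  have hstep : Primrec fun q : (List ℕ × ℕ) × ℕ × ℕ =>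
      if q.1.1.getD q.2.2 0 / 3 % 2 = q.2.1 % 2 ∧
        q.1.1.getD (q.2.2 + 2 * 2 ^ q.2.1) 0 / 3 % 2 = q.2.1 % 2 then q.2.2 + 2 ^ q.2.1
      else q.2.2 :=
    Primrec.ite (PrimrecPred.and (Primrec.eq.comp (htag.comp (hL.pair ha)) hj2)
      (Primrec.eq.comp (htag.comp (hL.pair (Primrec.nat_add.comp ha
        (Primrec.nat_mul.comp (Primrec.const 2) hpow)))) hj2)) (Primrec.nat_add.comp ha hpow) ha
  exact Primrec.nat_rec' Primrec.snd (Primrec.const 0) hstep.to₂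

theorem primrec_decodeBit : Primrec₂ decodeBit :=
  Primrec.nat_mod.comp (Primrec.nat_div.comp ((Primrec.list_getD 0).comp Primrec.fst
    (Primrec.nat_add.comp (primrec_syncPos.comp Primrec.fst (Primrec.succ.comp Primrec.snd))
      (primrec_two_pow.comp Primrec.snd))) (Primrec.const 6)) (Primrec.const 2)

theorem syncPos_spec {x : ℕ → ℕ} {L : List ℕ} {n i : ℕ}
    (hL : ∀ t ≤ 4 * 2 ^ i, L.getD t 0 = letterAt x (n + t)) {j : ℕ} (hj : j ≤ i + 1) :
    syncPos L j < 2 ^ j ∧ 2 ^ j ∣ n + 1 + syncPos L j := by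
  induction j with
  | zero => simp [syncPos]
  | succ j ih =>
    obtain ⟨hlt, q, hq⟩ := ih (by omega)
    have hle : 2 ^ j ≤ 2 ^ i := Nat.pow_le_pow_right (by norm_num) (by omega)
    have hpos : 0 < 2 ^ j := by positivity
    rw [syncPos_succ]
    set a := syncPos L j
    rw [hL a (by omega), hL (a + 2 * 2 ^ j) (by omega), letterAt_tag, letterAt_tag,
      show n + a + 1 = n + 1 + a by ring,
        show n + (a + 2 * 2 ^ j) + 1 = n + 1 + a + 2 ^ j * 2 by ring,
      hq, ← mul_add, pow_succ]
    rcases Nat.even_or_odd' q with ⟨p, rfl | rfl⟩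
    · have hdvd : 2 ^ j * 2 ∣ n + 1 + a := ⟨p, by rw [hq]; ring⟩
      rw [if_neg]
      · exact ⟨by omega, hdvd⟩
      · rintro ⟨h1, h2⟩
        rcases Nat.even_or_odd' p with ⟨s, rfl | rfl⟩
        · rw [val2_eq (j := j + 1) (q := s) (by ring)] at h2
          omega
        · rw [val2_eq (j := j + 1) (q := s) (by ring)] at h1
          omega
    · rw [val2_eq (j := j) (q := p) rfl, val2_eq (j := j) (q := p + 1) (by ring), if_pos ⟨rfl, rfl⟩]
      refine ⟨by omega, p + 1, ?_⟩
      rw [← add_assoc, hq]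
      ring

theorem decodeBit_eq {x : ℕ → ℕ} (hx : x ∈ cantorSpace) {L : List ℕ} {n i : ℕ}
    (hL : ∀ t ≤ 4 * 2 ^ i, L.getD t 0 = letterAt x (n + t)) : decodeBit L i = x i := by
  obtain ⟨hlt, q, hq⟩ := syncPos_spec hL le_rfl
  rw [pow_succ] at hlt hq
  rw [decodeBit, hL _ (by omega), letterAt_bit hx]
  congr 1
  refine val2_eq (q := q) ?_
  rw [← add_assoc,
    show n + syncPos L (i + 1) + 2 ^ i + 1 = n + 1 + syncPos L (i + 1) + 2 ^ i by ring,
    hq]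
  ring

theorem decodeBit_le (L : List ℕ) (i : ℕ) : decodeBit L i ≤ 1 := by
  simp only [decodeBit]
  omega

/-- Whether consecutive letters of a window increase by `1` modulo `3`. -/
def IsAscending (L : List ℕ) : Prop :=
  ∀ t < L.length - 1, L.getD (t + 1) 0 % 3 = (L.getD t 0 % 3 + 1) % 3

instance : DecidablePred IsAscending := fun L => by
  unfold IsAscending
  infer_instance

theorem primrecPred_isAscending : PrimrecPred IsAscending := by
  have h3 : Primrec fun q : List ℕ × ℕ => q.1.getD q.2 0 % 3 :=
    Primrec.nat_mod.comp ((Primrec.list_getD 0).comp Primrec.fst Primrec.snd) (Primrec.const 3)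
  have h : PrimrecRel fun (L : List ℕ) (t : ℕ) =>
      L.getD (t + 1) 0 % 3 = (L.getD t 0 % 3 + 1) % 3 :=
    Primrec.eq.comp (h3.comp (Primrec.fst.pair (Primrec.succ.comp Primrec.snd)))
      (Primrec.nat_mod.comp (Primrec.succ.comp h3) (Primrec.const 3))
  have h' : PrimrecRel fun (t : ℕ) (L : List ℕ) =>
      L.getD (t + 1) 0 % 3 = (L.getD t 0 % 3 + 1) % 3 := h.comp Primrec.snd Primrec.fst
  have hl : Primrec fun L : List ℕ => L.length - 1 :=
    Primrec.nat_sub.comp Primrec.list_length (Primrec.const 1)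
  refine PrimrecPred.of_eq (p := fun L : List ℕ => ∀ t ∈ List.range (L.length - 1),
      L.getD (t + 1) 0 % 3 = (L.getD t 0 % 3 + 1) % 3)
    (h'.forall_mem_list.comp (Primrec.list_range.comp hl) Primrec.id) fun L => by
    simp [IsAscending]

/-- The letters read along the second half of a word of length `2 * m`. -/
def windowOf {α : Type*} (F : List α → ℕ) (m : ℕ) (s : List α) : List ℕ :=
  (List.range (m + 1)).map fun t => F (s.take (m + t))

/-- The bit of index `i` decoded from a labelling `F` of the words over the list `A`. -/
def readBit {α : Type*} (A : List α) (F : List α → ℕ) (i : ℕ) : ℕ :=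
  decodeBit ((((allWords A (2 * (4 * 2 ^ i))).map (windowOf F (4 * 2 ^ i))).filter
    fun L => IsAscending L).getD 0 []) i

theorem windowOf_getD {α : Type*} (F : List α → ℕ) (m : ℕ) (s : List α) {t : ℕ} (ht : t ≤ m) :
    (windowOf F m s).getD t 0 = F (s.take (m + t)) := by
  rw [windowOf, List.getD_eq_getElem _ _ (by simpa using Nat.lt_succ_of_le ht)]
  simp

theorem windowOf_length {α : Type*} (F : List α → ℕ) (m : ℕ) (s : List α) :
    (windowOf F m s).length = m + 1 := by simp [windowOf]

theorem readBit_le {α : Type*} (A : List α) (F : List α → ℕ) (i : ℕ) : readBit A F i ≤ 1 :=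
  decodeBit_le _ _

theorem readBit_congr {α : Type*} (A : List α) {F F' : List α → ℕ} {i : ℕ}
    (h : ∀ s : List α, s.length ≤ 2 * (4 * 2 ^ i) → (∀ a ∈ s, a ∈ A) → F s = F' s) :
    readBit A F i = readBit A F' i := by
  have : (allWords A (2 * (4 * 2 ^ i))).map (windowOf F (4 * 2 ^ i)) =
      (allWords A (2 * (4 * 2 ^ i))).map (windowOf F' (4 * 2 ^ i)) := by
    refine List.map_congr_left fun s hs => List.map_congr_left fun t _ => ?_
    obtain ⟨hl, hA⟩ := mem_allWords.1 hs
    refine h _ ?_ fun a ha => hA a (List.mem_of_mem_take ha)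
    rw [List.length_take]
    omega
  rw [readBit, this, readBit]

theorem readBit_eq {α : Type*} {A : List α} {F : List α → ℕ} {x : ℕ → ℕ} (hx : x ∈ cantorSpace)
    (N : List α → ℕ) (hF : ∀ s, F s = letterAt x (N s))
    (hN₁ : ∀ s a, N (s ++ [a]) ≤ N s + 1) (hN₂ : ∀ s a, N s ≤ N (s ++ [a]) + 1) {i : ℕ}
    (hasc : ∃ s ∈ allWords A (2 * (4 * 2 ^ i)), ∃ n, ∀ t ≤ 4 * 2 ^ i,
      N (s.take (4 * 2 ^ i + t)) = n + t) :
    readBit A F i = x i := by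
  set m := 4 * 2 ^ i with hm
  set W := ((allWords A (2 * m)).map (windowOf F m)).filter fun L => IsAscending L with hW
  have hne : W ≠ [] := by
    obtain ⟨s, hs, n, hn⟩ := hasc
    refine List.ne_nil_of_mem (a := windowOf F m s) (List.mem_filter.2
      ⟨List.mem_map_of_mem hs, ?_⟩)
    rw [decide_eq_true_iff]
    intro t ht
    rw [windowOf_length] at ht
    rw [windowOf_getD _ _ _ (by omega), windowOf_getD _ _ _ (by omega), hF, hF, letterAt_mod,
      letterAt_mod, hn _ (by omega), hn _ (by omega)]
    omega
  obtain ⟨L, W', hLW⟩ := List.exists_cons_of_ne_nil hne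
  have hmem : L ∈ W := hLW ▸ List.mem_cons_self
  obtain ⟨hLmap, hLasc⟩ := List.mem_filter.1 hmem
  obtain ⟨s, hs, rfl⟩ := List.mem_map.1 hLmap
  have hlen := (mem_allWords.1 hs).1
  rw [decide_eq_true_iff] at hLasc
  have hstep : ∀ t ≤ m, N (s.take (m + t)) = N (s.take m) + t := by
    intro t
    induction t with
    | zero => simp
    | succ t ih =>
      intro ht
      have h1 := hLasc t (by rw [windowOf_length]; omega)
      rw [windowOf_getD _ _ _ (by omega), windowOf_getD _ _ _ (by omega), hF, hF, letterAt_mod,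
        letterAt_mod] at h1
      have h2 : s.take (m + (t + 1)) = s.take (m + t) ++ [s[m + t]'(by omega)] := by
        rw [← add_assoc, List.take_add_one, List.getElem?_eq_getElem (by omega)]
        rfl
      have h3 := hN₁ (s.take (m + t)) (s[m + t]'(by omega))
      have h4 := hN₂ (s.take (m + t)) (s[m + t]'(by omega))
      rw [h2] at h1 ⊢
      have := ih (by omega)
      omega
  have hread : readBit A F i = decodeBit (windowOf F m s) i := by
    rw [readBit, ← hm, ← hW, hLW]
    rfl
  rw [hread]
  refine decodeBit_eq hx (n := N (s.take m)) fun t ht => ?_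
  rw [windowOf_getD _ _ _ ht, hF, hstep t ht]

/-- The words of length at most `2 * (4 * 2 ^ i)`, on which `readBit A F i` depends. -/
def shortWords {α : Type*} (A : List α) (i : ℕ) : List (List α) :=
  (List.range (2 * (4 * 2 ^ i) + 1)).flatMap (allWords A)

theorem mem_shortWords {α : Type*} {A : List α} {i : ℕ} {s : List α} :
    s ∈ shortWords A i ↔ s.length ≤ 2 * (4 * 2 ^ i) ∧ ∀ a ∈ s, a ∈ A := by
  simp [shortWords, mem_allWords]

theorem primrec_shortWords {α : Type*} [Primcodable α] (A : List α) :
    Primrec (shortWords A) :=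
  Primrec.list_flatMap (Primrec.list_range.comp (Primrec.succ.comp (Primrec.nat_mul.comp
    (Primrec.const 2) (Primrec.nat_mul.comp (Primrec.const 4) primrec_two_pow))))
    ((primrec_allWords A).comp Primrec.snd).to₂

theorem primrec_readBit {α β : Type*} [Primcodable α] [Primcodable β] (A : List α)
    {F : β → List α → ℕ} (hF : Primrec₂ F) : Primrec₂ fun b i => readBit A (F b) i := by
  have hm : Primrec fun q : β × ℕ => 4 * 2 ^ q.2 :=
    Primrec.nat_mul.comp (Primrec.const 4) (primrec_two_pow.comp Primrec.snd)
  have hread : Primrec fun a : ((β × ℕ) × List α) × ℕ =>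
      F a.1.1.1 (a.1.2.take (4 * 2 ^ a.1.1.2 + a.2)) :=
    hF.comp (Primrec.fst.comp (Primrec.fst.comp Primrec.fst)) (Primrec.list_take.comp
      (Primrec.nat_add.comp (hm.comp (Primrec.fst.comp Primrec.fst)) Primrec.snd)
      (Primrec.snd.comp Primrec.fst))
  have hwin : Primrec fun a : (β × ℕ) × List α => windowOf (F a.1.1) (4 * 2 ^ a.1.2) a.2 :=
    Primrec.list_map (Primrec.list_range.comp (Primrec.succ.comp (hm.comp Primrec.fst)))
      hread.to₂
  have hmap : Primrec fun q : β × ℕ =>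
      (allWords A (2 * (4 * 2 ^ q.2))).map (windowOf (F q.1) (4 * 2 ^ q.2)) :=
    Primrec.list_map ((primrec_allWords A).comp (Primrec.nat_mul.comp (Primrec.const 2) hm))
      hwin.to₂
  exact (primrec_decodeBit.comp ((Primrec.list_getD []).comp
    ((Primrec.listFilter primrecPred_isAscending).comp hmap) (Primrec.const 0))
    Primrec.snd).to₂

/-! ### Geodesics in finitely generated groups -/

section Geodesic

variable {H : Type*} [Group H] {r : ℕ} {τ : Fin r → H}

theorem wordVal_map_true (τ : Fin r → H) (v : List (Fin r)) :
    wordVal τ (v.map fun a => (a, true)) = (v.map τ).prod := by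
  simp [wordVal, cover, FreeGroup.lift_mk, Function.comp_def]

theorem IsSymmGen.exists_inv (hτ : IsSymmGen τ) (v : List (Fin r)) :
    ∃ v' : List (Fin r), v'.length = v.length ∧ (v'.map τ).prod = ((v.map τ).prod)⁻¹ := by
  induction v with
  | nil => exact ⟨[], rfl, by simp⟩
  | cons a v ih =>
    obtain ⟨v', hl, hv⟩ := ih
    obtain ⟨b, hb⟩ := hτ.2 a
    exact ⟨v' ++ [b], by simp [hl], by simp [hv, hb]⟩

theorem IsSymmGen.exists_word (hτ : IsSymmGen τ) (h : H) :
    ∃ v : List (Fin r), (v.map τ).prod = h := by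
  have hmem : h ∈ Subgroup.closure (Set.range τ) := hτ.1 ▸ Subgroup.mem_top h
  induction hmem using Subgroup.closure_induction with
  | mem x hx =>
    obtain ⟨a, rfl⟩ := hx
    exact ⟨[a], by simp⟩
  | one => exact ⟨[], rfl⟩
  | mul x y _ _ hx hy =>
    obtain ⟨u, rfl⟩ := hx
    obtain ⟨v, rfl⟩ := hy
    exact ⟨u ++ v, by simp⟩
  | inv x _ hx =>
    obtain ⟨u, rfl⟩ := hx
    obtain ⟨v, -, hv⟩ := hτ.exists_inv u
    exact ⟨v, hv⟩

theorem wordNorm_le (τ : Fin r → H) (v : List (Fin r)) :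
    wordNorm τ (v.map τ).prod ≤ v.length := Nat.sInf_le ⟨v, rfl, rfl⟩

theorem IsSymmGen.exists_geodesic (hτ : IsSymmGen τ) (h : H) :
    ∃ v : List (Fin r), v.length = wordNorm τ h ∧ (v.map τ).prod = h := by
  obtain ⟨v, hv⟩ := hτ.exists_word h
  exact Nat.sInf_mem (s := {n | ∃ w : List (Fin r), w.length = n ∧ (w.map τ).prod = h})
    ⟨v.length, v, rfl, hv⟩

theorem IsSymmGen.wordNorm_mul_le (hτ : IsSymmGen τ) (g h : H) :
    wordNorm τ (g * h) ≤ wordNorm τ g + wordNorm τ h := by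
  obtain ⟨u, hu, rfl⟩ := hτ.exists_geodesic g
  obtain ⟨v, hv, rfl⟩ := hτ.exists_geodesic h
  rw [← hu, ← hv, ← List.prod_append, ← List.map_append, ← List.length_append]
  exact wordNorm_le τ _

theorem IsSymmGen.wordNorm_inv (hτ : IsSymmGen τ) (h : H) : wordNorm τ h⁻¹ = wordNorm τ h := by
  have key : ∀ g : H, wordNorm τ g⁻¹ ≤ wordNorm τ g := fun g => by
    obtain ⟨u, hu, rfl⟩ := hτ.exists_geodesic g
    obtain ⟨v, hv, hv'⟩ := hτ.exists_inv u
    rw [← hu, ← hv, ← hv']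
    exact wordNorm_le τ v
  exact le_antisymm (key h) (by simpa using key h⁻¹)

theorem IsSymmGen.wordNorm_take (hτ : IsSymmGen τ) {v : List (Fin r)}
    (hv : v.length = wordNorm τ (v.map τ).prod) {t : ℕ} (ht : t ≤ v.length) :
    wordNorm τ ((v.take t).map τ).prod = t := by
  have h1 := wordNorm_le τ (v.take t)
  have h2 := wordNorm_le τ (v.drop t)
  have h3 := hτ.wordNorm_mul_le ((v.take t).map τ).prod ((v.drop t).map τ).prod
  rw [← List.prod_append, ← List.map_append, List.take_append_drop] at h3
  rw [List.length_take] at h1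
  rw [List.length_drop] at h2
  omega

theorem IsSymmGen.exists_geodesic_of_infinite [Infinite H] (hτ : IsSymmGen τ) (m : ℕ) :
    ∃ v : List (Fin r), v.length = m ∧ wordNorm τ (v.map τ).prod = m := by
  obtain ⟨h, hh⟩ : ∃ h : H, m ≤ wordNorm τ h := by
    by_contra! hcon
    have hfin : (Set.univ : Set H).Finite := by
      refine ((List.finite_length_lt (Fin r) m).image fun v => (v.map τ).prod).subset
        fun h _ => ?_
      obtain ⟨v, hv, hv'⟩ := hτ.exists_geodesic h
      exact ⟨v, hv.trans_lt (hcon h), hv'⟩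
    exact Set.infinite_univ hfin
  obtain ⟨v, hv, rfl⟩ := hτ.exists_geodesic h
  exact ⟨v.take m, by rw [List.length_take]; omega, hτ.wordNorm_take hv (by omega)⟩

/-- From every element of an infinite group one can walk in such a way that the second half of
the walk moves away from the identity. -/
theorem IsSymmGen.exists_ascending [Infinite H] (hτ : IsSymmGen τ) (h : H) (m : ℕ) :
    ∃ s : List (Fin r), s.length = 2 * m ∧ ∃ n, ∀ t ≤ m,
      wordNorm τ (h * ((s.take (m + t)).map τ).prod) = n + t := by
  obtain ⟨W, hW, rfl⟩ := hτ.exists_geodesic h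
  have hWle : ∀ t ≤ W.length, wordNorm τ ((W.take t).map τ).prod = t :=
    fun t ht => hτ.wordNorm_take hW ht
  rcases le_total m W.length with hm | hm
  · have hsplit : (W.map τ).prod = ((W.take (W.length - m)).map τ).prod *
        ((W.drop (W.length - m)).map τ).prod := by
      rw [← List.prod_append, ← List.map_append, List.take_append_drop]
    obtain ⟨U, hU, hU'⟩ := hτ.exists_inv (W.drop (W.length - m))
    rw [List.length_drop] at hU
    refine ⟨U ++ W.drop (W.length - m), by simp [hU]; omega, W.length - m, fun t ht => ?_⟩
    rw [List.take_append, List.take_of_length_le (by omega), show m + t - U.length = t by omega,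
      List.map_append, List.prod_append, hU', hsplit, mul_assoc, mul_inv_cancel_left,
      ← List.prod_append, ← List.map_append, ← List.take_add]
    exact hWle _ (by omega)
  · obtain ⟨U, hU, hU'⟩ := hτ.exists_inv W
    obtain ⟨V, hV, hV'⟩ := hτ.exists_geodesic_of_infinite (2 * m)
    refine ⟨U ++ V.take (2 * m - W.length), by simp [hU]; omega, m - W.length, fun t ht => ?_⟩
    rw [List.take_append, List.take_of_length_le (by omega), List.take_take,
      show min (m + t - U.length) (2 * m - W.length) = m - W.length + t by omega,
      List.map_append, List.prod_append, hU', mul_inv_cancel_left]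
    exact hτ.wordNorm_take (hV.trans hV'.symm) (by omega)

end Geodesic

/-! ### A criterion for effectiveness -/

theorem primrec_reduce {k : ℕ} :
    Primrec (FreeGroup.reduce : List (Fin k × Bool) → List (Fin k × Bool)) := by
  have hx : Primrec fun q : (List (Fin k × Bool) × (Fin k × Bool) × List (Fin k × Bool)) ×
      (Fin k × Bool) × List (Fin k × Bool) => q.1.2.1 :=
    Primrec.fst.comp (Primrec.snd.comp Primrec.fst)
  have hhd : Primrec fun q : (List (Fin k × Bool) × (Fin k × Bool) × List (Fin k × Bool)) ×
      (Fin k × Bool) × List (Fin k × Bool) => q.2.1 := Primrec.fst.comp Primrec.snd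
  have htl : Primrec fun q : (List (Fin k × Bool) × (Fin k × Bool) × List (Fin k × Bool)) ×
      (Fin k × Bool) × List (Fin k × Bool) => q.2.2 := Primrec.snd.comp Primrec.snd
  have hif : Primrec fun q : (List (Fin k × Bool) × (Fin k × Bool) × List (Fin k × Bool)) ×
      (Fin k × Bool) × List (Fin k × Bool) =>
      if q.1.2.1.1 = q.2.1.1 ∧ q.1.2.1.2 = !q.2.1.2 then q.2.2 else q.1.2.1 :: q.2.1 :: q.2.2 :=
    Primrec.ite (PrimrecPred.and (Primrec.eq.comp (Primrec.fst.comp hx) (Primrec.fst.comp hhd))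
      (Primrec.eq.comp (Primrec.snd.comp hx) (Primrec.not.comp (Primrec.snd.comp hhd)))) htl
      (Primrec.list_cons.comp hx (Primrec.list_cons.comp hhd htl))
  have hstep : Primrec fun q : List (Fin k × Bool) × (Fin k × Bool) × List (Fin k × Bool) =>
      (List.casesOn q.2.2 [q.2.1] fun hd tl =>
        if q.2.1.1 = hd.1 ∧ q.2.1.2 = !hd.2 then tl else q.2.1 :: hd :: tl :
          List (Fin k × Bool)) :=
    Primrec.list_casesOn (h := fun (q : List (Fin k × Bool) × (Fin k × Bool) ×
        List (Fin k × Bool)) (p : (Fin k × Bool) × List (Fin k × Bool)) =>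
        if q.2.1.1 = p.1.1 ∧ q.2.1.2 = !p.1.2 then p.2 else q.2.1 :: p.1 :: p.2)
      (Primrec.snd.comp Primrec.snd)
      (Primrec.list_cons.comp (Primrec.fst.comp Primrec.snd) (Primrec.const [])) hif.to₂
  refine (Primrec.list_foldr Primrec.id (Primrec.const []) hstep.to₂).of_eq fun l => ?_
  induction l with
  | nil => rfl
  | cons a l ih =>
    rw [id, List.foldr_cons, FreeGroup.reduce.cons, ← ih]
    rfl

/-- The list of length `m` that codes a configuration on the free group whose letters have the
codes listed in `q`. -/
def fillCodes (k : ℕ) (q : List ℕ) (m : ℕ) : List ℕ :=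
  (List.range m).map fun j =>
    ((Encodable.decode (α := List (Fin k × Bool)) j).map fun _ => q.getD j 0 + 1).getD 0

/-- The coded pattern on the free group whose letters have the codes listed in `q`. -/
def patternOfCodes (k : ℕ) (q : List ℕ) (m : ℕ) : List (ℕ × ℕ) :=
  (List.range m).flatMap fun j =>
    ((Encodable.decode (α := List (Fin k × Bool)) j).map fun l =>
      (Encodable.encode (FreeGroup.reduce l), q.getD j 0)).toList

theorem primrec_fillCodes (k : ℕ) : Primrec₂ (fillCodes k) := by
  have hg : Primrec fun a : (List ℕ × ℕ) × ℕ => a.1.1.getD a.2 0 :=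
    (Primrec.list_getD 0).comp (Primrec.fst.comp Primrec.fst) Primrec.snd
  have hmap : Primrec fun a : (List ℕ × ℕ) × ℕ =>
      (Encodable.decode (α := List (Fin k × Bool)) a.2).map fun _ => a.1.1.getD a.2 0 + 1 :=
    Primrec.option_map (Primrec.decode.comp Primrec.snd)
      (Primrec.succ.comp (hg.comp Primrec.fst)).to₂
  exact (Primrec.list_map (Primrec.list_range.comp Primrec.snd)
    (Primrec.option_getD.comp hmap (Primrec.const 0)).to₂).to₂

theorem primrec_patternOfCodes (k : ℕ) : Primrec₂ (patternOfCodes k) := by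
  have hg : Primrec fun a : (List ℕ × ℕ) × ℕ => a.1.1.getD a.2 0 :=
    (Primrec.list_getD 0).comp (Primrec.fst.comp Primrec.fst) Primrec.snd
  have hpair : Primrec fun b : ((List ℕ × ℕ) × ℕ) × List (Fin k × Bool) =>
      (Encodable.encode (FreeGroup.reduce b.2), b.1.1.1.getD b.1.2 0) :=
    Primrec.pair (Primrec.encode.comp (primrec_reduce.comp Primrec.snd)) (hg.comp Primrec.fst)
  have hmap : Primrec fun a : (List ℕ × ℕ) × ℕ =>
      (Encodable.decode (α := List (Fin k × Bool)) a.2).map fun l =>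
        (Encodable.encode (FreeGroup.reduce l), a.1.1.getD a.2 0) :=
    Primrec.option_map (Primrec.decode.comp Primrec.snd) hpair.to₂
  exact (Primrec.list_flatMap (Primrec.list_range.comp Primrec.snd)
    (Primrec.optionToList.comp hmap).to₂).to₂

theorem encode_eq_encode_reduce_iff {k : ℕ} {g : FreeGroup (Fin k)} {l : List (Fin k × Bool)} :
    Encodable.encode g = Encodable.encode (FreeGroup.reduce l) ↔ g = FreeGroup.mk l := by
  change Encodable.encode g.toWord = _ ↔ _
  rw [Encodable.encode_inj, ← FreeGroup.toWord_mk, FreeGroup.toWord_inj]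

theorem mem_codedCylinder_patternOfCodes {k : ℕ} {A : Type*} [Encodable A]
    {z : FreeGroup (Fin k) → A} {q : List ℕ} {m : ℕ} :
    z ∈ codedCylinder (patternOfCodes k q m) ↔ ∀ j < m, ∀ l : List (Fin k × Bool),
      Encodable.decode j = some l → Encodable.encode (z (FreeGroup.mk l)) = q.getD j 0 := by
  constructor
  · intro h j hj l hl
    refine h (Encodable.encode (FreeGroup.reduce l), q.getD j 0) ?_ _
      (encode_eq_encode_reduce_iff.2 rfl)
    exact List.mem_flatMap.2 ⟨j, List.mem_range.2 hj, by simp [hl]⟩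
  · intro h p hp g hg
    obtain ⟨j, hj, hjp⟩ := List.mem_flatMap.1 hp
    rw [Option.mem_toList, Option.map_eq_some_iff] at hjp
    obtain ⟨l, hl, rfl⟩ := hjp
    rw [encode_eq_encode_reduce_iff.1 hg]
    exact h j (List.mem_range.1 hj) l hl

theorem fillCodes_eq_pref {k : ℕ} {A : Type*} [Encodable A]
    {z : FreeGroup (Fin k) → A} {q : List ℕ} {m : ℕ}
    (h : z ∈ codedCylinder (patternOfCodes k q m)) :
    fillCodes k q m = pref (confFun z) m := by
  refine List.map_congr_left fun j hj => ?_
  rw [confFun_eq]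
  cases hl : Encodable.decode (α := List (Fin k × Bool)) j with
  | none => rfl
  | some l =>
    simp [mem_codedCylinder_patternOfCodes.1 h j (List.mem_range.1 hj) l hl]

theorem exists_mem_codedCylinder {k : ℕ} {A : Type*} [Encodable A]
    (z : FreeGroup (Fin k) → A) (m : ℕ) :
    ∃ q, z ∈ codedCylinder (patternOfCodes k q m) := by
  refine ⟨pref (fun j => confFun z j - 1) m, mem_codedCylinder_patternOfCodes.2
    fun j hj l hl => ?_⟩
  rw [pref_getD _ hj, confFun_eq, hl]
  rfl

/-- A subshift is effective if membership of its pullback is refuted by a computable test on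
finite prefixes. -/
theorem isEffective_of_test {G : Type*} [Group G] {k : ℕ} {σ : Fin k → G} {A : Type*}
    [Encodable A] {X : Set (G → A)} {ι : Type*} [Primcodable ι] (c : ι → ℕ)
    (test : ι → List ℕ → Bool) (hc : Computable c) (htest : Computable₂ test)
    (h : ∀ z, z ∉ pullback (cover σ) X ↔ ∃ a, test a (pref (confFun z) (c a)) = true) :
    IsEffective σ X := by
  set bad : List (ℕ × ℕ) := [(Encodable.encode (1 : FreeGroup (Fin k)), 0),
    (Encodable.encode (1 : FreeGroup (Fin k)), 1)] with hbad
  have hempty : ∀ z : FreeGroup (Fin k) → A, z ∉ codedCylinder bad := fun z hz => by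
    have h0 := hz _ (by simp [hbad]) 1 (rfl : _ = (Encodable.encode (1 : FreeGroup (Fin k)), 0).1)
    have h1 := hz _ (by simp [hbad]) 1 (rfl : _ = (Encodable.encode (1 : FreeGroup (Fin k)), 1).1)
    simp only at h0 h1
    omega
  let pat : ι × List ℕ → List (ℕ × ℕ) := fun a =>
    bif test a.1 (fillCodes k a.2 (c a.1)) then patternOfCodes k a.2 (c a.1) else bad
  have hpat : Computable pat :=
    Computable.cond (htest.comp Computable.fst ((primrec_fillCodes k).to_comp.comp
      Computable.snd (hc.comp Computable.fst))) ((primrec_patternOfCodes k).to_comp.comp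
      Computable.snd (hc.comp Computable.fst)) (Computable.const bad)
  refine ⟨fun n => ((Encodable.decode (α := ι × List ℕ) n).map pat).getD bad,
    Computable.option_getD (Computable.option_map Computable.decode
      (hpat.comp Computable.snd).to₂) (Computable.const bad), ?_⟩
  ext z
  rw [Set.mem_compl_iff, h, Set.mem_iUnion]
  constructor
  · rintro ⟨a, ha⟩
    obtain ⟨q, hq⟩ := exists_mem_codedCylinder z (c a)
    refine ⟨Encodable.encode (a, q), ?_⟩
    beta_reduce
    rw [Encodable.encodek]
    simpa [pat, fillCodes_eq_pref hq, ha] using hq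
  · rintro ⟨n, hn⟩
    beta_reduce at hn
    cases hd : Encodable.decode (α := ι × List ℕ) n with
    | none =>
      rw [hd] at hn
      exact (hempty z hn).elim
    | some a =>
      rw [hd] at hn
      have hn' : z ∈ codedCylinder (pat a) := hn
      refine ⟨a.1, ?_⟩
      cases ht : test a.1 (fillCodes k a.2 (c a.1)) with
      | false =>
        simp only [pat, ht, cond_false] at hn'
        exact (hempty z hn').elim
      | true =>
        simp only [pat, ht, cond_true] at hn'
        rw [← fillCodes_eq_pref hn', ht]

theorem mem_pullback_cover {G : Type*} [Group G] {k : ℕ} {σ : Fin k → G} (hσ : IsSymmGen σ)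
    {A : Type*} {X : Set (G → A)} {z : FreeGroup (Fin k) → A} :
    z ∈ pullback (cover σ) X ↔
      (∀ l w, wordVal σ w = 1 → z (FreeGroup.mk (l ++ w)) = z (FreeGroup.mk l)) ∧
      ∀ y : G → A, (∀ l, z (FreeGroup.mk l) = y (wordVal σ l)) → y ∈ X := by
  constructor
  · rintro ⟨y, hy, rfl⟩
    refine ⟨fun l w hw => ?_, fun y' hy' => ?_⟩
    · change y (wordVal σ (l ++ w)) = y (wordVal σ l)
      rw [wordVal_append, hw, mul_one]
    · have : y' = y := funext fun g => by
        obtain ⟨w, rfl⟩ := exists_wordVal_eq hσ g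
        exact (hy' w).symm
      rwa [this]
  · rintro ⟨h₁, h₂⟩
    choose t ht using exists_wordVal_eq hσ
    have hz : ∀ l, z (FreeGroup.mk l) = z (FreeGroup.mk (t (wordVal σ l))) := fun l => by
      have := h₁ l (FreeGroup.invRev l ++ t (wordVal σ l)) (by
        rw [wordVal_append, ht, wordVal, ← FreeGroup.inv_mk, map_inv]
        exact inv_mul_cancel _)
      rw [← this, ← FreeGroup.mul_mk, ← FreeGroup.mul_mk, ← FreeGroup.inv_mk,
        mul_inv_cancel_left]
    refine ⟨fun g => z (FreeGroup.mk (t g)), h₂ _ hz, funext fun g => ?_⟩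
    have := hz g.toWord
    rw [wordVal, FreeGroup.mk_toWord] at this
    exact this.symm

/-! ### Subshifts coding an effectively closed class -/

section CodeShift

variable {H : Type*} [Group H] {r : ℕ}

/-- The binary sequence read from the configuration `y` around the element `h`. -/
def readBits (τ : Fin r → H) (y : H → Fin 12) (h : H) : ℕ → ℕ :=
  readBit (List.finRange r) fun s => (y (h * (s.map τ).prod)).val

/-- The configurations around every element of which a member of `Q` is read. -/
def codeShift (τ : Fin r → H) (Q : Set (ℕ → ℕ)) : Set (H → Fin 12) :=
  {y | ∀ h, readBits τ y h ∈ Q}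

theorem readBits_mem_cantorSpace (τ : Fin r → H) (y : H → Fin 12) (h : H) :
    readBits τ y h ∈ cantorSpace := fun _ => readBit_le _ _ _

theorem IsPi01Cantor.isClosed {Q : Set (ℕ → ℕ)} (hQ : IsPi01Cantor Q) : IsClosed Q := by
  obtain ⟨f, -, rfl⟩ := hQ
  have h1 : IsClosed cantorSpace := by
    have := (isCompact_cantorSpace_inter_cylinder []).isClosed
    rwa [show cantorSpace ∩ cylinder [] = cantorSpace by ext; simp [cylinder]] at this
  exact h1.sdiff (isOpen_iUnion fun n => isOpen_cylinder (f n))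

theorem codeShift_isSubshift (τ : Fin r → H) {Q : Set (ℕ → ℕ)} (hQ : IsClosed Q) :
    IsSubshift (codeShift τ Q) := by
  refine ⟨fun y hy g h => ?_, ?_⟩
  · have : readBits τ (shift g y) h = readBits τ y (g⁻¹ * h) := by
      simp only [readBits, shift, mul_assoc]
    rw [this]
    exact hy _
  · let _ : TopologicalSpace (Fin 12) := ⊥
    have _ : DiscreteTopology (Fin 12) := ⟨rfl⟩
    change IsClosed (codeShift τ Q)
    have hset : codeShift τ Q = ⋂ h, (fun y => readBits τ y h) ⁻¹' Q := by
      ext y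
      simp [codeShift]
    rw [hset]
    refine isClosed_iInter fun h => hQ.preimage (continuous_pi fun i => ?_)
    refine IsLocallyConstant.continuous ((IsLocallyConstant.iff_eventually_eq _).2 fun y => ?_)
    have hev : ∀ s ∈ (shortWords (List.finRange r) i).toFinset, ∀ᶠ y' in nhds y,
        y' (h * (s.map τ).prod) = y (h * (s.map τ).prod) := fun s _ =>
      ((isOpen_discrete {y (h * (s.map τ).prod)}).preimage
        (continuous_apply (h * (s.map τ).prod))).mem_nhds (Set.mem_singleton _)
    filter_upwards [(Filter.eventually_all_finset _).2 hev] with y' hy'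
    refine readBit_congr _ fun s hs hA => ?_
    rw [hy' s (List.mem_toFinset.2 (mem_shortWords.2 ⟨hs, hA⟩))]

/-- The letter read, from the list `p` of codes, at the positive word `v ++ s`. -/
def readCode (p : List ℕ) (v s : List (Fin r)) : ℕ :=
  p.getD (Encodable.encode ((v ++ s).map fun a => (a, true))) 0 - 1

/-- A bound on the codes of the words on which the bit of index `i` read at `v` depends. -/
def codeBound (v : List (Fin r)) (i : ℕ) : ℕ :=
  ((shortWords (List.finRange r) i).map fun s =>
    Encodable.encode ((v ++ s).map fun a => (a, true))).sum + 1

theorem primrec_posWord : Primrec₂ fun v s : List (Fin r) =>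
    (v ++ s).map fun a => (a, true) :=
  (Primrec.list_map (Primrec.list_append.comp Primrec.fst Primrec.snd)
    (Primrec.pair Primrec.snd (Primrec.const true)).to₂).to₂

theorem primrec_readCode : Primrec₂ fun (q : List ℕ × List (Fin r)) (s : List (Fin r)) =>
    readCode q.1 q.2 s := by
  have h : Primrec fun a : (List ℕ × List (Fin r)) × List (Fin r) =>
      readCode a.1.1 a.1.2 a.2 :=
    Primrec.nat_sub.comp ((Primrec.list_getD 0).comp (Primrec.fst.comp Primrec.fst)
      (Primrec.encode.comp (primrec_posWord.comp (Primrec.snd.comp Primrec.fst) Primrec.snd)))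
      (Primrec.const 1)
  exact h.to₂

theorem primrec_readBit_readCode : Primrec₂ fun (q : List ℕ × List (Fin r)) (i : ℕ) =>
    readBit (List.finRange r) (readCode q.1 q.2) i :=
  primrec_readBit (List.finRange r) primrec_readCode

theorem primrec_codeBound : Primrec₂ (codeBound (r := r)) := by
  have h : Primrec fun a : (List (Fin r) × ℕ) × List (Fin r) =>
      Encodable.encode ((a.1.1 ++ a.2).map fun a => (a, true)) :=
    Primrec.encode.comp (primrec_posWord.comp (Primrec.fst.comp Primrec.fst) Primrec.snd)
  exact (Primrec.succ.comp (primrec_list_sum.comp (Primrec.list_map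
    ((primrec_shortWords _).comp Primrec.snd) h.to₂))).to₂

theorem readBit_readCode (z : FreeGroup (Fin r) → Fin 12) {v : List (Fin r)} {i m : ℕ}
    (h : codeBound v i ≤ m) :
    readBit (List.finRange r) (readCode (pref (confFun z) m) v) i =
      readBit (List.finRange r)
        (fun s => (z (FreeGroup.mk ((v ++ s).map fun a => (a, true)))).val) i := by
  refine readBit_congr _ fun s hs hA => ?_
  have hlt : Encodable.encode ((v ++ s).map fun a => (a, true)) < m := by
    refine lt_of_lt_of_le (Nat.lt_succ_of_le ?_) h
    exact List.le_sum_of_mem (List.mem_map.2 ⟨s, mem_shortWords.2 ⟨hs, hA⟩, rfl⟩)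
  rw [readCode, pref_getD _ hlt, confFun_encode]
  rfl

theorem readBit_readCode_eq_readBits {τ : Fin r → H} {z : FreeGroup (Fin r) → Fin 12}
    {y : H → Fin 12} (hz : ∀ l, z (FreeGroup.mk l) = y (wordVal τ l)) {v : List (Fin r)}
    {i m : ℕ} (h : codeBound v i ≤ m) :
    readBit (List.finRange r) (readCode (pref (confFun z) m) v) i =
      readBits τ y (v.map τ).prod i := by
  rw [readBit_readCode z h, readBits]
  simp only [hz, wordVal_map_true]
  simp only [List.map_append, List.prod_append]

theorem baireLE_mSet_codeShift (τ : Fin r → H) (Q : Set (ℕ → ℕ)) :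
    BaireLE Q (mSet (pullback (cover τ) (codeShift τ Q))) := by
  have hΨ : Primrec fun a : ℕ × List ℕ =>
      readBit (List.finRange r) (readCode a.2 []) a.1 :=
    Primrec₂.comp (g := fun a : ℕ × List ℕ => (a.2, ([] : List (Fin r))))
      primrec_readBit_readCode (Primrec.snd.pair (Primrec.const [])) Primrec.fst
  refine BaireLE.of_tt (codeBound ([] : List (Fin r)))
    (fun n p => readBit (List.finRange r) (readCode p []) n)
    (primrec_codeBound.comp (Primrec.const []) Primrec.id).to_comp hΨ.to_comp.to₂ ?_
  rintro _ ⟨_, ⟨y, hy, rfl⟩, rfl⟩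
  convert hy 1 using 1
  funext n
  rw [readBit_readCode_eq_readBits (τ := τ) (y := y) (fun l => rfl) le_rfl]
  rfl

theorem codeShift_isEffective {τ : Fin r → H} (hτ : IsSymmGen τ) (hrp : RecursivelyPresented τ)
    {Q : Set (ℕ → ℕ)} (hQ : IsPi01Cantor Q) : IsEffective τ (codeShift τ Q) := by
  obtain ⟨e, he, hwp⟩ := hrp
  obtain ⟨f, hf, rfl⟩ := hQ
  let test₁ : List (Fin r × Bool) × ℕ → List ℕ → Bool := fun a p =>
    Option.casesOn (e a.2) false fun w =>
      !decide (p.getD (Encodable.encode a.1) 0 = p.getD (Encodable.encode (a.1 ++ w)) 0)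
  let test₂ : List (Fin r) × ℕ → List ℕ → Bool := fun a p =>
    decide ((List.range (f a.2).length).map (readBit (List.finRange r) (readCode p a.1)) = f a.2)
  let c₁ : List (Fin r × Bool) × ℕ → ℕ := fun a =>
    Option.casesOn (e a.2) 0 fun w => Encodable.encode a.1 + Encodable.encode (a.1 ++ w) + 1
  let c₂ : List (Fin r) × ℕ → ℕ := fun a =>
    ((List.range (f a.2).length).map (codeBound a.1)).sum
  have htest₁ : Computable₂ test₁ := by
    have h : Primrec fun b : ((List (Fin r × Bool) × ℕ) × List ℕ) × List (Fin r × Bool) =>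
        !decide (b.1.2.getD (Encodable.encode b.1.1.1) 0 =
          b.1.2.getD (Encodable.encode (b.1.1.1 ++ b.2)) 0) := by
      have hp := Primrec.snd.comp (Primrec.fst (α := (List (Fin r × Bool) × ℕ) × List ℕ)
        (β := List (Fin r × Bool)))
      have hl := Primrec.fst.comp (Primrec.fst.comp
        (Primrec.fst (α := (List (Fin r × Bool) × ℕ) × List ℕ) (β := List (Fin r × Bool))))
      exact Primrec.not.comp (PrimrecPred.decide (Primrec.eq.comp
        ((Primrec.list_getD 0).comp hp (Primrec.encode.comp hl))
        ((Primrec.list_getD 0).comp hp (Primrec.encode.comp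
          (Primrec.list_append.comp hl Primrec.snd)))))
    exact (Computable.option_casesOn (he.comp (Computable.snd.comp Computable.fst))
      (Computable.const false) h.to_comp.to₂).to₂
  have htest₂ : Computable₂ test₂ := by
    have h : Primrec fun b : ((List (Fin r) × ℕ) × List ℕ) × ℕ =>
        readBit (List.finRange r) (readCode b.1.2 b.1.1.1) b.2 :=
      Primrec₂.comp (g := fun b : ((List (Fin r) × ℕ) × List ℕ) × ℕ => (b.1.2, b.1.1.1))
        primrec_readBit_readCode
        ((Primrec.snd.comp Primrec.fst).pair (Primrec.fst.comp (Primrec.fst.comp Primrec.fst)))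
        Primrec.snd
    have hfa : Computable fun b : (List (Fin r) × ℕ) × List ℕ => f b.1.2 :=
      hf.comp (Computable.snd.comp Computable.fst)
    exact (Primrec.eq.decide.to_comp.comp (computable_list_map
      (Primrec.list_range.to_comp.comp (Computable.list_length.comp hfa)) h.to_comp.to₂) hfa).to₂
  have hc₁ : Computable c₁ := by
    have h : Primrec fun b : (List (Fin r × Bool) × ℕ) × List (Fin r × Bool) =>
        Encodable.encode b.1.1 + Encodable.encode (b.1.1 ++ b.2) + 1 := by
      have hl := Primrec.fst.comp
        (Primrec.fst (α := List (Fin r × Bool) × ℕ) (β := List (Fin r × Bool)))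
      exact Primrec.succ.comp (Primrec.nat_add.comp (Primrec.encode.comp hl)
        (Primrec.encode.comp (Primrec.list_append.comp hl Primrec.snd)))
    exact Computable.option_casesOn (he.comp Computable.snd) (Computable.const 0) h.to_comp.to₂
  have hc₂ : Computable c₂ := by
    have h : Primrec fun b : (List (Fin r) × ℕ) × ℕ => codeBound b.1.1 b.2 :=
      primrec_codeBound.comp (Primrec.fst.comp Primrec.fst) Primrec.snd
    exact primrec_list_sum.to_comp.comp (computable_list_map (Primrec.list_range.to_comp.comp
      (Computable.list_length.comp (hf.comp Computable.snd))) h.to_comp.to₂)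
  have hread : ∀ (z : FreeGroup (Fin r) → Fin 12) (y : H → Fin 12),
      (∀ l, z (FreeGroup.mk l) = y (wordVal τ l)) → ∀ a m, c₂ a ≤ m →
      (test₂ a (pref (confFun z) m) = true ↔
        readBits τ y (a.1.map τ).prod ∈ cylinder (f a.2)) := by
    intro z y hz a m hm
    have hmap : (List.range (f a.2).length).map (readBit (List.finRange r)
        (readCode (pref (confFun z) m) a.1)) =
        pref (readBits τ y (a.1.map τ).prod) (f a.2).length := by
      refine List.map_congr_left fun i hi => readBit_readCode_eq_readBits hz (le_trans ?_ hm)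
      exact List.le_sum_of_mem (List.mem_map_of_mem hi)
    rw [← pref_prefix_iff]
    simp only [test₂, hmap, decide_eq_true_iff]
    constructor
    · intro h
      rw [h]
    · intro h
      exact (h.eq_of_length (pref_length _ _).symm).symm
  have hcongr : ∀ (z : FreeGroup (Fin r) → Fin 12) (a : List (Fin r × Bool) × ℕ) (m : ℕ),
      c₁ a ≤ m → (test₁ a (pref (confFun z) m) = true ↔ ∃ w, e a.2 = some w ∧
        z (FreeGroup.mk (a.1 ++ w)) ≠ z (FreeGroup.mk a.1)) := by
    intro z a m hm
    cases hw : e a.2 with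
    | none => simp [test₁, hw]
    | some w =>
      have hm' : Encodable.encode a.1 + Encodable.encode (a.1 ++ w) + 1 ≤ m := by
        simpa [c₁, hw] using hm
      simp only [test₁, hw]
      rw [pref_getD _ (by omega), pref_getD _ (by omega), confFun_encode, confFun_encode,
        Bool.not_eq_true', decide_eq_false_iff_not, Nat.add_right_cancel_iff,
        Encodable.encode_inj]
      constructor
      · exact fun h => ⟨w, rfl, fun h' => h h'.symm⟩
      · rintro ⟨_, ⟨⟩, h⟩ h'
        exact h h'.symm
  refine isEffective_of_test (ι := (List (Fin r × Bool) × ℕ) × (List (Fin r) × ℕ))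
    (fun a => c₁ a.1 + c₂ a.2) (fun a p => test₁ a.1 p || test₂ a.2 p)
    (Primrec.nat_add.to_comp.comp (hc₁.comp Computable.fst) (hc₂.comp Computable.snd))
    (Primrec.or.to_comp.comp
      (htest₁.comp (Computable.fst.comp Computable.fst) Computable.snd)
      (htest₂.comp (Computable.snd.comp Computable.fst) Computable.snd)).to₂ fun z => ?_
  simp only [Bool.or_eq_true]
  constructor
  · intro hz
    rw [mem_pullback_cover hτ, not_and_or] at hz
    rcases hz with hz | hz
    · push Not at hz
      obtain ⟨l, w, hw, hne⟩ := hz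
      obtain ⟨n, hn⟩ := (hwp w).1 hw
      exact ⟨((l, n), ([], 0)), Or.inl ((hcongr z (l, n) _ (Nat.le_add_right _ _)).2
        ⟨w, hn, hne⟩)⟩
    · push Not at hz
      obtain ⟨y, hy, hyX⟩ := hz
      simp only [codeShift, Set.mem_ofPred_eq, not_forall] at hyX
      obtain ⟨h, hh⟩ := hyX
      obtain ⟨v, rfl⟩ := hτ.exists_word h
      simp only [Set.mem_sdiff, readBits_mem_cantorSpace, true_and, not_not,
        Set.mem_iUnion] at hh
      obtain ⟨j, hj⟩ := hh
      exact ⟨(([], 0), (v, j)), Or.inr ((hread z y hy (v, j) _ (Nat.le_add_left _ _)).2 hj)⟩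
  · rintro ⟨a, ha⟩ hz
    rcases ha with ha | ha
    · obtain ⟨w, hw, hne⟩ := (hcongr z a.1 _ (Nat.le_add_right _ _)).1 ha
      exact hne (((mem_pullback_cover hτ).1 hz).1 _ w ((hwp w).2 ⟨_, hw⟩))
    · obtain ⟨y, hy, rfl⟩ := hz
      have := (hread _ y (fun l => rfl) a.2 _ (Nat.le_add_left _ _)).1 ha
      exact (hy _).2 (Set.mem_iUnion.2 ⟨_, this⟩)

end CodeShift

section CodeShift

variable {H : Type*} [Group H] {r : ℕ} {τ : Fin r → H}

/-- The radial configuration coding the binary sequence `x`. -/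
noncomputable def radialPoint (τ : Fin r → H) {x : ℕ → ℕ} (hx : x ∈ cantorSpace) : H → Fin 12 :=
  fun h => ⟨letterAt x (wordNorm τ h), letterAt_lt hx _⟩

theorem readBits_radialPoint [Infinite H] (hτ : IsSymmGen τ) {x : ℕ → ℕ} (hx : x ∈ cantorSpace)
    (h : H) : readBits τ (radialPoint τ hx) h = x := by
  have hgen : ∀ a, wordNorm τ (τ a) ≤ 1 := fun a => by simpa using wordNorm_le τ [a]
  funext i
  refine readBit_eq hx (fun s => wordNorm τ (h * (s.map τ).prod)) (fun s => rfl)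
    (fun s a => ?_) (fun s a => ?_) ?_
  · have := hτ.wordNorm_mul_le (h * (s.map τ).prod) (τ a)
    have := hgen a
    simp only [List.map_append, List.map_singleton, List.prod_append, List.prod_singleton,
      ← mul_assoc]
    omega
  · have h1 := hτ.wordNorm_mul_le (h * (s.map τ).prod * τ a) (τ a)⁻¹
    rw [hτ.wordNorm_inv, mul_inv_cancel_right] at h1
    have := hgen a
    simp only [List.map_append, List.map_singleton, List.prod_append, List.prod_singleton,
      ← mul_assoc]
    omega
  · obtain ⟨s, hs, hn⟩ := hτ.exists_ascending h (4 * 2 ^ i)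
    exact ⟨s, mem_allWords.2 ⟨hs, fun a _ => List.mem_finRange a⟩, hn⟩

theorem radialPoint_mem_codeShift [Infinite H] (hτ : IsSymmGen τ) {Q : Set (ℕ → ℕ)} {x : ℕ → ℕ}
    (hx : x ∈ cantorSpace) (hxQ : x ∈ Q) : radialPoint τ hx ∈ codeShift τ Q := fun h => by
  rwa [readBits_radialPoint hτ hx]

theorem DecidableWordProblem.recursivelyPresented (h : DecidableWordProblem τ) :
    RecursivelyPresented τ := by
  obtain ⟨φ, hφ, hwp⟩ := h
  let g : List (Fin r × Bool) → Option (List (Fin r × Bool)) := fun w =>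
    bif φ w then some w else none
  have hg : Computable g := Computable.cond hφ Computable.option_some (Computable.const none)
  refine ⟨fun n => (Encodable.decode (α := List (Fin r × Bool)) n).bind g,
    Computable.option_bind Computable.decode (hg.comp Computable.snd).to₂, fun w => ?_⟩
  rw [← hwp]
  constructor
  · intro hw
    refine ⟨Encodable.encode w, ?_⟩
    beta_reduce
    rw [Encodable.encodek]
    simp [g, hw]
  · rintro ⟨n, hn⟩
    obtain ⟨w', -, hw'⟩ := Option.bind_eq_some_iff.1 hn
    cases hφw : φ w' with
    | false => simp [g, hφw] at hw'
    | true =>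
      simp only [g, hφw, cond_true, Option.some.injEq] at hw'
      rwa [← hw']

theorem DecidableWordProblem.computable_wordNorm (hτ : IsSymmGen τ)
    (h : DecidableWordProblem τ) : Computable fun l => wordNorm τ (wordVal τ l) := by
  obtain ⟨φ, hφ, hwp⟩ := h
  let p : List (Fin r × Bool) → ℕ → Bool := fun l n =>
    (allWords (List.finRange r) n).any fun w => φ (l ++ w.map fun a => (a, true))
  have hp : Computable₂ p := by
    have hin : Primrec fun b : (List (Fin r × Bool) × ℕ) × List (Fin r) =>
        b.1.1 ++ b.2.map fun a => (a, true) :=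
      Primrec.list_append.comp (Primrec.fst.comp Primrec.fst)
        (Primrec.list_map Primrec.snd (Primrec.pair Primrec.snd (Primrec.const true)).to₂)
    exact (computable_list_any ((primrec_allWords _).to_comp.comp Computable.snd)
      (hφ.comp hin.to_comp).to₂).to₂
  have hspec : ∀ l n, p l n = true ↔
      ∃ w : List (Fin r), w.length = n ∧ (w.map τ).prod = (wordVal τ l)⁻¹ := by
    intro l n
    simp only [p, List.any_eq_true, hwp, wordVal_append, wordVal_map_true, mem_allWords,
      List.mem_finRange, implies_true, and_true]
    refine exists_congr fun w => and_congr_right fun _ => ?_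
    rw [mul_eq_one_iff_inv_eq, eq_comm]
  have hrf : Partrec fun l => Nat.rfind fun n => (Part.some (p l n) : Part Bool) :=
    Partrec.rfind hp.partrec₂
  refine hrf.of_eq fun l => Part.eq_some_iff.2 (Nat.mem_rfind.2 ⟨?_, fun {m} hm => ?_⟩)
  · beta_reduce
    rw [Part.mem_some_iff, eq_comm, hspec, ← hτ.wordNorm_inv]
    exact hτ.exists_geodesic _
  · beta_reduce at hm
    rw [Part.mem_some_iff, eq_comm, Bool.eq_false_iff, Ne, hspec]
    rintro ⟨w, hw, hw'⟩
    have := wordNorm_le τ w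
    rw [hw', hτ.wordNorm_inv] at this
    omega

/-- The letter at norm `N` determined by a finite prefix `p` of the coded sequence. -/
def letterOf (p : List ℕ) (N : ℕ) : ℕ :=
  letterAt (fun i => p.getD i 0) N

theorem primrec_letterOf : Primrec₂ letterOf := by
  have hval : Primrec fun q : List ℕ × ℕ => val2 (q.2 + 1) :=
    primrec_val2.comp (Primrec.succ.comp Primrec.snd)
  have h1 : Primrec fun q : List ℕ × ℕ => q.2 % 3 :=
    Primrec.nat_mod.comp Primrec.snd (Primrec.const 3)
  have h2 : Primrec fun q : List ℕ × ℕ => 3 * (val2 (q.2 + 1) % 2) :=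
    Primrec.nat_mul.comp (Primrec.const 3) (Primrec.nat_mod.comp hval (Primrec.const 2))
  have h3 : Primrec fun q : List ℕ × ℕ => 6 * q.1.getD (val2 (q.2 + 1)) 0 :=
    Primrec.nat_mul.comp (Primrec.const 6)
      (Primrec₂.comp (f := fun (l : List ℕ) n => l.getD n 0) (Primrec.list_getD 0) Primrec.fst hval)
  exact (Primrec.nat_add.comp (Primrec.nat_add.comp h1 h2) h3).of_eq fun q => rfl

theorem letterOf_pref (x : ℕ → ℕ) {N m : ℕ} (h : N + 2 ≤ m) :
    letterOf (pref x m) N = letterAt x N := by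
  simp only [letterOf, letterAt]
  rw [pref_getD x (lt_of_le_of_lt (val2_le _) h)]

theorem mSet_codeShift_baireLE [Infinite H] (hτ : IsSymmGen τ) (hdec : DecidableWordProblem τ)
    {Q : Set (ℕ → ℕ)} (hQ : Q ⊆ cantorSpace) :
    BaireLE (mSet (pullback (cover τ) (codeShift τ Q))) Q := by
  have hnorm := hdec.computable_wordNorm hτ
  let c : ℕ → ℕ := fun n => ((Encodable.decode (α := List (Fin r × Bool)) n).map fun l =>
      wordNorm τ (wordVal τ l) + 2).getD 0
  let Ψ : ℕ → List ℕ → ℕ := fun n p => ((Encodable.decode (α := List (Fin r × Bool)) n).map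
    fun l => letterOf p (wordNorm τ (wordVal τ l)) + 1).getD 0
  have hc : Computable c := by
    have h : Computable₂ fun (_ : ℕ) (l : List (Fin r × Bool)) =>
        wordNorm τ (wordVal τ l) + 2 :=
      (Computable.comp (f := fun n : ℕ => n + 2)
        (g := fun b : ℕ × List (Fin r × Bool) => wordNorm τ (wordVal τ b.2))
        (Computable.succ.comp Computable.succ) (hnorm.comp Computable.snd)).to₂
    exact Computable.option_getD (Computable.option_map Computable.decode h)
      (Computable.const 0)
  have hΨ : Computable₂ Ψ := by
    have hl : Computable fun b : (ℕ × List ℕ) × List (Fin r × Bool) =>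
        letterOf b.1.2 (wordNorm τ (wordVal τ b.2)) :=
      Computable₂.comp (f := letterOf) (g := fun b : (ℕ × List ℕ) × List (Fin r × Bool) => b.1.2)
        (h := fun b => wordNorm τ (wordVal τ b.2)) primrec_letterOf.to_comp
        (Computable.snd.comp Computable.fst) (hnorm.comp Computable.snd)
    have h : Computable₂ fun (a : ℕ × List ℕ) (l : List (Fin r × Bool)) =>
        letterOf a.2 (wordNorm τ (wordVal τ l)) + 1 := (Computable.succ.comp hl).to₂
    exact (Computable.option_getD (Computable.option_map
      (Computable.decode.comp Computable.fst) h) (Computable.const 0)).to₂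
  refine BaireLE.of_tt c Ψ hc hΨ fun x hx => ?_
  refine ⟨_, ⟨_, radialPoint_mem_codeShift hτ (hQ hx) hx, rfl⟩, funext fun n => ?_⟩
  rw [confFun_eq]
  cases hl : Encodable.decode (α := List (Fin r × Bool)) n with
  | none => simp [Ψ, hl]
  | some l =>
    have hcn : c n = wordNorm τ (wordVal τ l) + 2 := by simp only [c, hl]; rfl
    simp only [Ψ, hl, Option.map_some, Option.getD_some, hcn]
    rw [letterOf_pref x le_rfl]
    rfl

end CodeShift

/-- Suppose `G` simulates `H` through the epimorphism `ρ`: the pullback of every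
effective `H`-subshift is a sofic `G`-subshift. Then (1) `M_eff(H) ⊆ M_sof(G)`;
(2) if `H` is infinite and recursively presented, `M_SFT(G)` contains a degree bounded
below by the maximal `Π⁰₁` Medvedev degree; (3) if `H` is infinite with decidable word
problem, `M_sof(G)` contains all `Π⁰₁` Medvedev degrees. -/
theorem statement16 {G H : Type*} [Group G] [Group H] {k r : ℕ}
    (σ : Fin k → G) (hσ : IsSymmGen σ) (τ : Fin r → H) (hτ : IsSymmGen τ)
    (ρ : G →* H) (hρ : Function.Surjective ρ)
    (hsim : ∀ (A : Type) [Finite A] [Encodable A] (X : Set (H → A)),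
      IsSubshift X → IsEffective τ X → IsSofic (pullback ρ X)) :
    (∀ P : Set (ℕ → ℕ), IsEffDeg τ P → IsSoficDeg σ P) ∧
    (Infinite H → RecursivelyPresented τ →
      ∃ (n : ℕ) (X : Set (G → Fin n)), IsSFT X ∧ X.Nonempty ∧
        ∃ P : Set (ℕ → ℕ), IsMaxPi01 P ∧ BaireLE P (mSet (pullback (cover σ) X))) ∧
    (Infinite H → DecidableWordProblem τ →
      ∀ P : Set (ℕ → ℕ), IsPi01Deg P → IsSoficDeg σ P) := by
  have hcantor : ∀ Q, IsPi01Cantor Q → Q ⊆ cantorSpace := by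
    rintro _ ⟨f, -, rfl⟩
    exact Set.sdiff_subset
  refine ⟨fun P => isSoficDeg_of_isEffDeg hσ hτ hρ hsim, fun _ hrp => ?_, fun _ hdec P hP => ?_⟩
  · obtain ⟨x, hx⟩ := dnc_nonempty
    have hsofic := hsim (Fin 12) (codeShift τ dnc)
      (codeShift_isSubshift τ dnc_isPi01Cantor.isClosed)
      (codeShift_isEffective hτ hrp dnc_isPi01Cantor)
    have hne : (pullback ρ (codeShift τ dnc)).Nonempty :=
      ⟨_, _, radialPoint_mem_codeShift hτ (hcantor _ dnc_isPi01Cantor hx) hx, rfl⟩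
    obtain ⟨n, Y, hY, hYne, hle⟩ := hsofic.exists_isSFT hσ hne
    exact ⟨n, Y, hY, hYne, dnc, dnc_isMaxPi01, ((baireLE_mSet_codeShift τ dnc).trans
      (pullback_medEquiv hσ hτ hρ (codeShift τ dnc)).2).trans hle⟩
  · obtain ⟨Q, hQ, ⟨x, hx⟩, hPQ⟩ := hP
    refine isSoficDeg_of_isEffDeg hσ hτ hρ hsim ⟨12, codeShift τ Q,
      codeShift_isSubshift τ hQ.isClosed,
      codeShift_isEffective hτ hdec.recursivelyPresented hQ,
      ⟨_, radialPoint_mem_codeShift hτ (hcantor _ hQ hx) hx⟩, ?_⟩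
    exact ⟨(mSet_codeShift_baireLE hτ hdec (hcantor _ hQ)).trans hPQ.2,
      hPQ.1.trans (baireLE_mSet_codeShift τ Q)⟩

end MedvedevFormal
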